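/- arXiv:2004.10175 — 2 statements merged into one kernel-verified Lean document; each statement's English description precedes it below -/
import Mathlib

section
/- Friedland–Hayman inequality for convex cones (Theorem 1.1/2.3): Let n ≥ 2 and let Γ ⊆ ℝⁿ be a nonempty open convex cone (λx ∈ Γ whenever x ∈ Γ and λ > 0). Let Γ₁, Γ₂ ⊆ Γ be nonempty disjoint open cones. For i = 1, 2, let αᵢ > 0 and let uᵢ : ℝⁿ → ℝ satisfy: uᵢ is continuous on the closure of Γᵢ; uᵢ > 0 on Γᵢ; uᵢ is harmonic on Γᵢ, i.e. twice continuously differentiable on Γᵢ with ∑_{j=1}^{n} ∂²uᵢ/∂x_j² = 0 there; uᵢ is homogeneous of degree αᵢ, i.e. uᵢ(λx) = λ^{αᵢ}·uᵢ(x) for all λ > 0 and all x in the closure of Γᵢ; uᵢ(y) = 0 for every y ∈ Γ ∩ ∂Γᵢ; and uᵢ satisfies the Neumann condition on ∂Γ ∩ ∂Γᵢ, namely at every point y ∈ (∂Γ ∩ ∂Γᵢ) \ {0} the function uᵢ is differentiable within the closure of Γᵢ and its derivative at y annihilates every outer supporting normal ν of Γ at y (⟨∇uᵢ(y), ν⟩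 = 0). Then α₁ + α₂ ≥ 2. -/
open Set
open scoped RealInnerProductSpace

noncomputable section

/-- A unit vector `ν` is an outer supporting normal of `Ω` at `y` if
`⟨ν, z − y⟩ ≤ 0` for all `z ∈ Ω`. -/
def IsOuterNormal {E : Type*} [NormedAddCommGroup E] [InnerProductSpace ℝ E]
    (Ω : Set E) (y ν : E) : Prop :=
  ‖ν‖ = 1 ∧ ∀ z ∈ Ω, ⟪ν, z - y⟫ ≤ 0

/-- A cone: closed under multiplication by positive scalars. -/
def IsConeSet {E : Type*} [AddCommMonoid E] [Module ℝ E] (Γ : Set E) : Prop :=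
  ∀ x ∈ Γ, ∀ l : ℝ, 0 < l → l • x ∈ Γ

/-- The Euclidean Laplacian, as the sum of the second partial derivatives. -/
noncomputable def lapl {n : ℕ} (u : EuclideanSpace ℝ (Fin n) → ℝ)
    (x : EuclideanSpace ℝ (Fin n)) : ℝ :=
  ∑ j : Fin n,
    fderiv ℝ (fun y => fderiv ℝ u y (EuclideanSpace.single j 1)) x (EuclideanSpace.single j 1)

/-- The hypotheses on the homogeneous harmonic function `u` of degree `α` on the cone `Γi ⊆ Γ`,
with Dirichlet conditions on `Γ ∩ ∂Γi` and Neumann conditions on `∂Γ ∩ ∂Γi`. -/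
structure FHData {n : ℕ} (Γ Γi : Set (EuclideanSpace ℝ (Fin n)))
    (u : EuclideanSpace ℝ (Fin n) → ℝ) (α : ℝ) : Prop where
  cont : ContinuousOn u (closure Γi)
  pos : ∀ x ∈ Γi, 0 < u x
  smooth : ContDiffOn ℝ 2 u Γi
  harmonic : ∀ x ∈ Γi, lapl u x = 0
  homog : ∀ l : ℝ, 0 < l → ∀ x ∈ closure Γi, u (l • x) = l ^ α * u x
  dirichlet : ∀ y ∈ Γ ∩ frontier Γi, u y = 0
  neumann : ∀ y ∈ (frontier Γ ∩ frontier Γi) \ {0},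
    ∃ D : EuclideanSpace ℝ (Fin n) →L[ℝ] ℝ,
      HasFDerivWithinAt u D (closure Γi) y ∧
        ∀ ν : EuclideanSpace ℝ (Fin n), IsOuterNormal Γ y ν → D ν = 0


section helpers

variable {E : Type*} [NormedAddCommGroup E] [InnerProductSpace ℝ E]

/-- The penalty in one variable. -/
def psi (a : E) (ε β : ℝ) (y x : E) : ℝ :=
  -(β * Real.log (‖x - y‖ + ε)) - ‖x‖ ^ 2 + ε * ⟪a, x⟫

/-- The gradient of `psi`. -/
def psiG (a : E) (ε β : ℝ) (y x : E) : E :=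
  -((β / (‖x - y‖ + ε) / ‖x - y‖) • (x - y)) - (2 : ℝ) • x + ε • a

theorem hasFDerivAt_norm_sub {x y : E} (h : x ≠ y) :
    HasFDerivAt (fun z : E => ‖z - y‖) (innerSL ℝ ((1 / ‖x - y‖) • (x - y))) x := by
  have hne : ‖x - y‖ ≠ 0 := norm_ne_zero_iff.2 (sub_ne_zero.2 h)
  have h1 : HasFDerivAt (fun z : E => ‖z - y‖ ^ 2) _ x :=
    ((hasFDerivAt_id x).sub_const y).norm_sq
  have h2 := h1.sqrt (pow_ne_zero 2 hne)
  have h3 : (fun z : E => √(‖z - y‖ ^ 2)) = fun z : E => ‖z - y‖ := by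
    funext z; exact Real.sqrt_sq (norm_nonneg _)
  rw [h3] at h2
  convert h2 using 1
  ext v
  simp [Real.sqrt_sq (norm_nonneg _), inner_smul_left]
  field_simp

theorem hasFDerivAt_psi (a : E) {ε β : ℝ} (hε : 0 < ε) {x y : E} (h : x ≠ y) :
    HasFDerivAt (psi a ε β y) (innerSL ℝ (psiG a ε β y x)) x := by
  have hpos : ‖x - y‖ + ε ≠ 0 := by positivity
  have h1 := (((hasFDerivAt_norm_sub h).add_const ε).log hpos).const_mul β
  have h2 : HasFDerivAt (fun z : E => ‖z‖ ^ 2) _ x := (hasFDerivAt_id x).norm_sq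
  have h3 : HasFDerivAt (fun z : E => ε * ⟪a, z⟫) _ x :=
    ((innerSL ℝ a).hasFDerivAt (x := x)).const_mul ε
  have h4 := (h1.neg.sub h2).add h3
  have h5 : HasFDerivAt (psi a ε β y) _ x := h4
  refine h5.congr_fderiv ?_
  ext v
  simp [psiG, inner_add_left, inner_sub_left, inner_smul_left, inner_neg_left]
  ring

theorem localSub {Γ Γ₁ : Set E} (hΓconv : Convex ℝ Γ) (h1open : IsOpen Γ₁) (h1sub : Γ₁ ⊆ Γ)
    {u : E → ℝ} (hc : ContinuousOn u (closure Γ₁))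
    (hd : ∀ y ∈ Γ ∩ frontier Γ₁, u y = 0) {x : E} (hx : x ∈ closure Γ₁) (hux : 0 < u x) :
    ∃ δ > 0, Γ ∩ Metric.ball x δ ⊆ Γ₁ := by
  have h := (hc x hx).eventually (lt_mem_nhds hux)
  obtain ⟨δ, hδ, hb⟩ := Metric.mem_nhdsWithin_iff.1 h
  refine ⟨δ, hδ, ?_⟩
  have hpre : IsPreconnected (Γ ∩ Metric.ball x δ) :=
    (hΓconv.inter (convex_ball x δ)).isPreconnected
  apply hpre.subset_left_of_subset_union h1open (isClosed_closure (s := Γ₁)).isOpen_compl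
  · exact disjoint_compl_right.mono_left subset_closure
  · rintro z ⟨hz, hzb⟩
    by_cases hzc : z ∈ closure Γ₁
    · left
      by_contra hn
      have : z ∈ frontier Γ₁ := ⟨hzc, by rwa [h1open.interior_eq]⟩
      have h0 := hd z ⟨hz, this⟩
      have : 0 < u z := hb ⟨hzb, hzc⟩
      linarith
    · exact Or.inr hzc
  · obtain ⟨z, hz, hzd⟩ := Metric.mem_closure_iff.1 hx δ hδ
    exact ⟨z, ⟨h1sub hz, by rwa [Metric.mem_ball']⟩, hz⟩

theorem normal_facts {Γ : Set E} (hΓopen : IsOpen Γ) (hΓcone : IsConeSet Γ) {x ν a : E}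
    (hν : IsOuterNormal Γ x ν) (ha : a ∈ Γ) : 0 ≤ ⟪ν, x⟫ ∧ ⟪ν, a⟫ < 0 := by
  have key : ∀ z ∈ Γ, ∀ l : ℝ, 0 < l → l * ⟪ν, z⟫ ≤ ⟪ν, x⟫ := by
    intro z hz l hl
    have := hν.2 _ (hΓcone z hz l hl)
    rw [inner_sub_right, inner_smul_right] at this
    linarith
  have hle : ∀ z ∈ Γ, ⟪ν, z⟫ ≤ 0 := by
    intro z hz
    by_contra! hc
    have := key z hz ((|⟪ν, x⟫| + 1) / ⟪ν, z⟫) (by positivity)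
    rw [div_mul_cancel₀ _ hc.ne'] at this
    have := le_abs_self ⟪ν, x⟫
    linarith
  constructor
  · by_contra! hc
    have hna : ⟪ν, a⟫ ≤ 0 := hle a ha
    have := key a ha ((-⟪ν, x⟫) / 2 / (1 - ⟪ν, a⟫)) (div_pos (by linarith) (by linarith))
    have h1 : (1 - ⟪ν, a⟫) > 0 := by linarith
    rw [div_mul_eq_mul_div, div_le_iff₀ h1] at this
    nlinarith
  · obtain ⟨δ, hδ, hb⟩ := Metric.isOpen_iff.1 hΓopen a ha
    have hm : a + (δ / 2) • ν ∈ Γ := by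
      apply hb
      rw [Metric.mem_ball, dist_eq_norm, add_sub_cancel_left, norm_smul, hν.1,
        Real.norm_of_nonneg (by positivity)]
      linarith
    have := hle _ hm
    rw [inner_add_right, inner_smul_right, real_inner_self_eq_norm_sq, hν.1] at this
    linarith

/-- Second order data at `0` of a function of one variable. -/
def HasSecond (f : ℝ → ℝ) (f2 : ℝ) : Prop :=
  ∃ f' : ℝ → ℝ, (∀ᶠ t in nhds 0, HasDerivAt f (f' t) t) ∧ HasDerivAt f' f2 0

theorem HasSecond.add {f g : ℝ → ℝ} {f2 g2 : ℝ} (hf : HasSecond f f2) (hg : HasSecond g g2) :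
    HasSecond (fun t => f t + g t) (f2 + g2) := by
  obtain ⟨f', hf1, hf2⟩ := hf
  obtain ⟨g', hg1, hg2⟩ := hg
  refine ⟨fun t => f' t + g' t, ?_, hf2.add hg2⟩
  filter_upwards [hf1, hg1] with t h1 h2 using h1.add h2

theorem HasSecond.nonpos {f : ℝ → ℝ} {f2 : ℝ} (hf : HasSecond f f2) (hm : IsLocalMax f 0) :
    f2 ≤ 0 := by
  obtain ⟨f', h1, h2⟩ := hf
  by_contra! hc
  have hd : deriv f =ᶠ[nhds 0] f' := by
    filter_upwards [h1] with t ht using ht.deriv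
  have hdd : deriv (deriv f) 0 = f2 := by rw [hd.deriv_eq, h2.deriv]
  have hmin := isLocalMin_of_deriv_deriv_pos (by rw [hdd]; exact hc) hm.deriv_eq_zero
    h1.self_of_nhds.continuousAt
  have hconst : f =ᶠ[nhds 0] fun _ => f 0 := by
    filter_upwards [hm, hmin] with t ha hb using le_antisymm ha hb
  have h0 : deriv f =ᶠ[nhds 0] fun _ => 0 := by
    filter_upwards [hconst.eventuallyEq_nhds] with t ht
    rw [ht.deriv_eq]; simp
  have : deriv (deriv f) 0 = 0 := by rw [h0.deriv_eq]; simp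
  linarith

theorem hasSecond_log {u : E → ℝ} {Γ₁ : Set E} (ho : IsOpen Γ₁) (hu : ContDiffOn ℝ 2 u Γ₁)
    (hp : ∀ z ∈ Γ₁, 0 < u z) {x : E} (hx : x ∈ Γ₁) (v : E) :
    HasSecond (fun t : ℝ => Real.log (u (x + t • v)))
      (fderiv ℝ (fderiv ℝ u) x v v / u x - (fderiv ℝ u x v / u x) ^ 2) := by
  have hline : ∀ t : ℝ, HasDerivAt (fun t : ℝ => x + t • v) v t := fun t => by
    simpa using ((hasDerivAt_id t).smul_const v).const_add x
  have hder : ∀ z ∈ Γ₁, HasFDerivAt u (fderiv ℝ u z) z := fun z hz =>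
    ((hu.contDiffAt (ho.mem_nhds hz)).differentiableAt (by norm_num)).hasFDerivAt
  have hev : ∀ᶠ t : ℝ in nhds 0, x + t • v ∈ Γ₁ := by
    apply (hline 0).continuousAt.eventually
    simpa using ho.mem_nhds hx
  have h2 : HasFDerivAt (fderiv ℝ u) (fderiv ℝ (fderiv ℝ u) x) x := by
    have : ContDiffAt ℝ 1 (fderiv ℝ u) x :=
      (hu.contDiffAt (ho.mem_nhds hx)).fderiv_right (by norm_num)
    exact (this.differentiableAt (by norm_num)).hasFDerivAt
  have hl1 : ∀ z ∈ Γ₁, ∀ t : ℝ, x + t • v = z →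
      HasDerivAt (fun t : ℝ => u (x + t • v)) (fderiv ℝ u z v) t := by
    rintro z hz t rfl
    exact (hder _ hz).comp_hasDerivAt t (hline t)
  have hl2 : HasDerivAt (fun t : ℝ => fderiv ℝ u (x + t • v) v)
      (fderiv ℝ (fderiv ℝ u) x v v) 0 := by
    have h2' : HasFDerivAt (fderiv ℝ u) (fderiv ℝ (fderiv ℝ u) x) (x + (0 : ℝ) • v) := by
      simpa using h2
    have h3 : HasDerivAt (fun t : ℝ => fderiv ℝ u (x + t • v)) (fderiv ℝ (fderiv ℝ u) x v) 0 :=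
      HasFDerivAt.comp_hasDerivAt (0 : ℝ) h2' (hline 0)
    have h4 : HasFDerivAt (fun L : E →L[ℝ] ℝ => L v)
        (ContinuousLinearMap.apply ℝ ℝ v) (fderiv ℝ u (x + (0 : ℝ) • v)) :=
      (ContinuousLinearMap.apply ℝ ℝ v).hasFDerivAt
    exact HasFDerivAt.comp_hasDerivAt (0 : ℝ) h4 h3
  refine ⟨fun t => fderiv ℝ u (x + t • v) v / u (x + t • v), ?_, ?_⟩
  · filter_upwards [hev] with t ht
    exact (hl1 _ ht t rfl).log (hp _ ht).ne'
  · have hz : x + (0 : ℝ) • v = x := by simp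
    have := hl2.fun_div (hl1 x hx 0 hz) (by rw [hz]; exact (hp x hx).ne')
    refine this.congr_deriv ?_
    rw [hz]
    have := (hp x hx).ne'
    field_simp

theorem hasSecond_neglog (β : ℝ) {s : ℝ} (hs : 0 < s) (c : ℝ) :
    HasSecond (fun t : ℝ => -(β * Real.log (s + 2 * t * c))) (4 * β * c ^ 2 / s ^ 2) := by
  have hline : ∀ t : ℝ, HasDerivAt (fun t : ℝ => s + 2 * t * c) (2 * c) t := fun t => by
    simpa using (((hasDerivAt_id t).const_mul 2).mul_const c).const_add s
  have hev : ∀ᶠ t : ℝ in nhds 0, 0 < s + 2 * t * c := by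
    apply (hline 0).continuousAt.eventually
    simpa using lt_mem_nhds hs
  refine ⟨fun t => -(β * (2 * c / (s + 2 * t * c))), ?_, ?_⟩
  · filter_upwards [hev] with t ht
    exact (((hline t).log ht.ne').const_mul β).neg
  · have := (((hasDerivAt_const (0 : ℝ) (2 * c)).fun_div (hline 0)
      (by simpa using hs.ne')).const_mul β).fun_neg
    refine this.congr_deriv ?_
    have := hs.ne'
    simp
    field_simp
    ring

theorem hasSecond_quad (a x v : E) (ε : ℝ) :
    HasSecond (fun t : ℝ => -‖x + t • v‖ ^ 2 + ε * ⟪a, x + t • v⟫) (-2 * ‖v‖ ^ 2) := by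
  have heq : (fun t : ℝ => -‖x + t • v‖ ^ 2 + ε * ⟪a, x + t • v⟫) = fun t : ℝ =>
      (-‖x‖ ^ 2 + ε * ⟪a, x⟫) + (-2 * ⟪x, v⟫ + ε * ⟪a, v⟫) * t + (- ‖v‖ ^ 2) * (t * t) := by
    funext t
    rw [norm_add_sq_real, inner_add_right, inner_smul_right, inner_smul_right, norm_smul, mul_pow,
      Real.norm_eq_abs, sq_abs]
    ring
  rw [heq]
  refine ⟨fun t => (-2 * ⟪x, v⟫ + ε * ⟪a, v⟫) + (- ‖v‖ ^ 2) * (t + t), ?_, ?_⟩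
  · refine Filter.Eventually.of_forall fun t => ?_
    have := (((hasDerivAt_id t).const_mul (-2 * ⟪x, v⟫ + ε * ⟪a, v⟫)).const_add
      (-‖x‖ ^ 2 + ε * ⟪a, x⟫)).add
      (((hasDerivAt_id t).mul (hasDerivAt_id t)).const_mul (- ‖v‖ ^ 2))
    refine this.congr_deriv ?_
    simp
  · have := ((((hasDerivAt_id (0 : ℝ)).add (hasDerivAt_id (0 : ℝ))).const_mul
      (- ‖v‖ ^ 2))).const_add (-2 * ⟪x, v⟫ + ε * ⟪a, v⟫)
    refine this.congr_deriv ?_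
    ring

end helpers

theorem lapl_eq {n : ℕ} {u : EuclideanSpace ℝ (Fin n) → ℝ} {Γ₁ : Set (EuclideanSpace ℝ (Fin n))}
    (ho : IsOpen Γ₁) (hu : ContDiffOn ℝ 2 u Γ₁) {x : EuclideanSpace ℝ (Fin n)} (hx : x ∈ Γ₁)
    (b : OrthonormalBasis (Fin n) ℝ (EuclideanSpace ℝ (Fin n))) :
    ∑ j, fderiv ℝ (fderiv ℝ u) x (b j) (b j) = lapl u x := by
  have hd : DifferentiableAt ℝ (fderiv ℝ u) x := by
    have : ContDiffAt ℝ 1 (fderiv ℝ u) x :=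
      (hu.contDiffAt (ho.mem_nhds hx)).fderiv_right (by norm_num)
    exact this.differentiableAt (by norm_num)
  set B := fderiv ℝ (fderiv ℝ u) x with hB
  let T : EuclideanSpace ℝ (Fin n) →ₗ[ℝ] EuclideanSpace ℝ (Fin n) :=
    { toFun := fun v => (InnerProductSpace.toDual ℝ _).symm (B v)
      map_add' := by intro v w; simp
      map_smul' := by intro c v; simp }
  have hT : ∀ b : OrthonormalBasis (Fin n) ℝ (EuclideanSpace ℝ (Fin n)),
      ∑ j, B (b j) (b j) = LinearMap.trace ℝ _ T := by
    intro b
    rw [LinearMap.trace_eq_sum_inner T b]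
    refine Finset.sum_congr rfl fun j _ => ?_
    rw [real_inner_comm]
    exact (InnerProductSpace.toDual_symm_apply).symm
  rw [hT b, ← hT (EuclideanSpace.basisFun (Fin n) ℝ)]
  unfold lapl
  refine Finset.sum_congr rfl fun j _ => ?_
  rw [fderiv_clm_apply hd (by fun_prop)]
  simp [hB]

theorem boundary {n : ℕ} {Γ Γ₁ : Set (EuclideanSpace ℝ (Fin n))}
    (hΓopen : IsOpen Γ) (hΓconv : Convex ℝ Γ) (hΓcone : IsConeSet Γ)
    (h1open : IsOpen Γ₁) (h1sub : Γ₁ ⊆ Γ) {u : EuclideanSpace ℝ (Fin n) → ℝ} {α : ℝ}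
    (hα : 0 < α) (hu : FHData Γ Γ₁ u α) {a x y : EuclideanSpace ℝ (Fin n)} {ε β : ℝ}
    (hε : 0 < ε) (hβ : 0 ≤ β) (ha : a ∈ Γ) (hy : y ∈ closure Γ) (hxy : x ≠ y)
    (hx : x ∈ closure Γ₁) (hux : 0 < u x)
    (hmax : IsLocalMaxOn (fun z => Real.log (u z) + psi a ε β y z) (closure Γ₁) x) :
    x ∈ Γ₁ := by
  by_contra hx1
  have hfr : x ∈ frontier Γ₁ := ⟨hx, by rwa [h1open.interior_eq]⟩
  have hxΓ : x ∉ Γ := fun h => hux.ne' (hu.dirichlet x ⟨h, hfr⟩)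
  have hfrΓ : x ∈ frontier Γ := ⟨closure_mono h1sub hx, by rwa [hΓopen.interior_eq]⟩
  have hx0 : x ≠ 0 := by
    rintro rfl
    have := hu.homog 2 two_pos 0 hx
    rw [smul_zero] at this
    have h2 : (1 : ℝ) < 2 ^ α := Real.one_lt_rpow (by norm_num) hα
    nlinarith
  obtain ⟨D, hD, hDν⟩ := hu.neumann x ⟨⟨hfrΓ, hfr⟩, hx0⟩
  have hder := (hD.log hux.ne').add (hasFDerivAt_psi a (β := β) hε hxy).hasFDerivWithinAt
  set D' := (u x)⁻¹ • D + innerSL ℝ (psiG a ε β y x) with hD'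
  obtain ⟨δ, hδ, hsub⟩ := localSub hΓconv h1open h1sub hu.cont hu.dirichlet hx hux
  have hle : ∀ z ∈ Γ, D' (z - x) ≤ 0 := by
    intro z hz
    refine hmax.hasFDerivWithinAt_nonpos hder ?_
    -- a small piece of the segment lies in the closure
    have hne : 0 < ‖z - x‖ := norm_pos_iff.2 (sub_ne_zero.2 fun h => hxΓ (h ▸ hz))
    set τ : ℝ := min 1 (δ / 2 / ‖z - x‖) with hτ
    have hτ0 : 0 < τ := lt_min one_pos (by positivity)
    have hτ1 : τ ≤ 1 := min_le_left _ _
    have hw : ∀ t : ℝ, 0 < t → t ≤ τ → x + t • (z - x) ∈ Γ₁ := by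
      intro t ht0 ht
      apply hsub
      constructor
      · have := hΓconv.combo_interior_closure_mem_interior (x := z) (y := x)
          (by rwa [hΓopen.interior_eq]) hfrΓ.1 ht0 (b := 1 - t) (by linarith) (by ring)
        rw [hΓopen.interior_eq] at this
        convert this using 1
        module
      · rw [Metric.mem_ball, dist_eq_norm, add_sub_cancel_left, norm_smul,
          Real.norm_of_nonneg ht0.le]
        have : t ≤ δ / 2 / ‖z - x‖ := ht.trans (min_le_right _ _)
        rw [le_div_iff₀ hne] at this
        linarith
    apply mem_posTangentConeAt_of_frequently_mem
    apply Filter.Eventually.frequently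
    filter_upwards [Ioo_mem_nhdsGT hτ0] with t ht
    exact subset_closure (hw t ht.1 ht.2.le)
  -- D' is strictly negative on outer normals
  have hneg : ∀ ν, IsOuterNormal Γ x ν → D' ν < 0 := by
    intro ν hν
    obtain ⟨hνx, hνa⟩ := normal_facts hΓopen hΓcone hν ha
    have hνy : ⟪ν, y - x⟫ ≤ 0 := by
      have hcl : IsClosed {z : EuclideanSpace ℝ (Fin n) | ⟪ν, z - x⟫ ≤ 0} :=
        isClosed_le (by fun_prop) continuous_const
      exact closure_minimal (fun z hz => hν.2 z hz) hcl hy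
    have h1 : ⟪x - y, ν⟫ ≥ 0 := by
      rw [← neg_sub, inner_neg_left, real_inner_comm]; linarith
    have h2 : 0 ≤ (β / (‖x - y‖ + ε) / ‖x - y‖) * ⟪x - y, ν⟫ := by positivity
    have h3 : ε * ⟪ν, a⟫ < 0 := mul_neg_of_pos_of_neg hε hνa
    simp only [hD', add_apply, smul_apply, hDν ν hν,
      innerSL_apply_apply, psiG, inner_add_left, inner_sub_left, inner_neg_left,
      real_inner_smul_left, smul_zero, zero_add]
    rw [inner_sub_left] at h2
    rw [real_inner_comm] at hνx h3
    linarith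
  set q := (InnerProductSpace.toDual ℝ _).symm D' with hq
  have hqD : ∀ v, ⟪q, v⟫ = D' v := fun v => InnerProductSpace.toDual_symm_apply
  by_cases hq0 : q = 0
  · obtain ⟨f, hf⟩ := geometric_hahn_banach_open_point hΓconv hΓopen hxΓ
    set p := (InnerProductSpace.toDual ℝ _).symm f with hp
    have hpf : ∀ v, ⟪p, v⟫ = f v := fun v => InnerProductSpace.toDual_symm_apply
    have hp0 : p ≠ 0 := by
      intro h0
      have := hf a ha
      rw [← hpf, ← hpf, h0] at this
      simp at this
    have hν : IsOuterNormal Γ x (‖p‖⁻¹ • p) := by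
      refine ⟨by rw [norm_smul, norm_inv, norm_norm, inv_mul_cancel₀ (norm_ne_zero_iff.2 hp0)], fun z hz => ?_⟩
      rw [real_inner_smul_left, hpf, map_sub]
      have := hf z hz
      have : f z - f x ≤ 0 := by linarith
      exact mul_nonpos_of_nonneg_of_nonpos (by positivity) this
    have := hneg _ hν
    rw [← hqD, hq0] at this
    simp at this
  · have hν : IsOuterNormal Γ x (‖q‖⁻¹ • q) := by
      refine ⟨by rw [norm_smul, norm_inv, norm_norm, inv_mul_cancel₀ (norm_ne_zero_iff.2 hq0)], fun z hz => ?_⟩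
      rw [real_inner_smul_left, hqD]
      exact mul_nonpos_of_nonneg_of_nonpos (by positivity) (hle z hz)
    have := hneg _ hν
    rw [← hqD, real_inner_smul_right, real_inner_self_eq_norm_sq] at this
    have : 0 ≤ ‖q‖⁻¹ * ‖q‖ ^ 2 := by positivity
    linarith

theorem psi_symm {E : Type*} [NormedAddCommGroup E] [InnerProductSpace ℝ E] (a : E) (ε β : ℝ)
    (x y : E) : psi a ε β y x + (-‖y‖ ^ 2 + ε * ⟪a, y⟫) =
      psi a ε β x y + (-‖x‖ ^ 2 + ε * ⟪a, x⟫) := by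
  unfold psi
  rw [norm_sub_rev]
  ring

/-- The two-point functional. -/
def bigW {E : Type*} [NormedAddCommGroup E] [InnerProductSpace ℝ E] (u₁ u₂ : E → ℝ)
    (a : E) (ε β : ℝ) (x y : E) : ℝ :=
  Real.log (u₁ x) + Real.log (u₂ y) + (psi a ε β y x + (-‖y‖ ^ 2 + ε * ⟪a, y⟫))

theorem log_gradient_eq {n : ℕ} {Γ₁ : Set (EuclideanSpace ℝ (Fin n))}
    (h1open : IsOpen Γ₁) {u : EuclideanSpace ℝ (Fin n) → ℝ}
    (hs : ContDiffOn ℝ 2 u Γ₁) (hp : ∀ z ∈ Γ₁, 0 < u z)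
    {a x y : EuclideanSpace ℝ (Fin n)} {ε β : ℝ}
    (hε : 0 < ε) (hxy : x ≠ y) (hx : x ∈ Γ₁)
    (hmax : IsLocalMax (fun z => Real.log (u z) + psi a ε β y z) x)
    (b : OrthonormalBasis (Fin n) ℝ (EuclideanSpace ℝ (Fin n))) :
    ∑ j, (fderiv ℝ u x (b j) / u x) ^ 2 = ‖psiG a ε β y x‖ ^ 2 := by
  have hd : HasFDerivAt u (fderiv ℝ u x) x :=
    ((hs.contDiffAt (h1open.mem_nhds hx)).differentiableAt (by norm_num)).hasFDerivAt
  have hder := (hd.log (hp x hx).ne').add (hasFDerivAt_psi a (β := β) hε hxy)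
  have h0 := hmax.hasFDerivAt_eq_zero hder
  rw [← b.sum_sq_inner_left (psiG a ε β y x)]
  refine Finset.sum_congr rfl fun j _ => ?_
  have := congrArg (fun L : EuclideanSpace ℝ (Fin n) →L[ℝ] ℝ => L (b j)) h0
  simp only [add_apply, smul_apply, innerSL_apply_apply, smul_eq_mul, zero_apply] at this
  have h1 : fderiv ℝ u x (b j) / u x = -⟪psiG a ε β y x, b j⟫ := by
    rw [div_eq_inv_mul]; linarith
  rw [h1, neg_sq]

theorem interior_ineq {n : ℕ} {Γ₁ Γ₂ : Set (EuclideanSpace ℝ (Fin n))}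
    (h1open : IsOpen Γ₁) (h2open : IsOpen Γ₂) {u₁ u₂ : EuclideanSpace ℝ (Fin n) → ℝ}
    (hs1 : ContDiffOn ℝ 2 u₁ Γ₁) (hp1 : ∀ z ∈ Γ₁, 0 < u₁ z) (hl1 : ∀ z ∈ Γ₁, lapl u₁ z = 0)
    (hs2 : ContDiffOn ℝ 2 u₂ Γ₂) (hp2 : ∀ z ∈ Γ₂, 0 < u₂ z) (hl2 : ∀ z ∈ Γ₂, lapl u₂ z = 0)
    {a x y : EuclideanSpace ℝ (Fin n)} {ε β : ℝ}
    (hε : 0 < ε) (hxy : x ≠ y) (hx : x ∈ Γ₁) (hy : y ∈ Γ₂)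
    (hmax : ∀ᶠ p in nhds (x, y), bigW u₁ u₂ a ε β p.1 p.2 ≤ bigW u₁ u₂ a ε β x y) :
    4 * β / (‖x - y‖ + ε) ^ 2 ≤
      ‖psiG a ε β y x‖ ^ 2 + ‖psiG a ε β x y‖ ^ 2 + 4 * n := by
  have hm1 : IsLocalMax (fun z => Real.log (u₁ z) + psi a ε β y z) x := by
    have hc : Filter.Tendsto (fun z : EuclideanSpace ℝ (Fin n) => (z, y)) (nhds x) (nhds (x, y)) :=
      Continuous.tendsto (by fun_prop) x
    filter_upwards [hc.eventually hmax] with z hz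
    unfold bigW at hz
    linarith
  have hm2 : IsLocalMax (fun z => Real.log (u₂ z) + psi a ε β x z) y := by
    have hc : Filter.Tendsto (fun z : EuclideanSpace ℝ (Fin n) => (x, z)) (nhds y) (nhds (x, y)) :=
      Continuous.tendsto (by fun_prop) y
    filter_upwards [hc.eventually hmax] with z hz
    unfold bigW at hz
    rw [psi_symm a ε β x z, psi_symm a ε β x y] at hz
    linarith
  have hr : 0 < ‖x - y‖ := norm_pos_iff.2 (sub_ne_zero.2 hxy)
  set r := ‖x - y‖ with hrdef
  set e : EuclideanSpace ℝ (Fin n) := r⁻¹ • (x - y) with he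
  have hen : ‖e‖ = 1 := by
    rw [he, norm_smul, norm_inv, Real.norm_of_nonneg hr.le, ← hrdef, inv_mul_cancel₀ hr.ne']
  have hxe : x - y = r • e := by rw [he, smul_smul, mul_inv_cancel₀ hr.ne', one_smul]
  let b : OrthonormalBasis (Fin n) ℝ (EuclideanSpace ℝ (Fin n)) := EuclideanSpace.basisFun (Fin n) ℝ
  let w : OrthonormalBasis (Fin n) ℝ (EuclideanSpace ℝ (Fin n)) := b.map ((ℝ ∙ e)ᗮ.reflection)
  have hw : ∀ j, w j = b j - (2 * ⟪e, b j⟫) • e := by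
    intro j
    simp only [w, OrthonormalBasis.map_apply]
    rw [Submodule.reflection_orthogonal_apply, Submodule.reflection_singleton_apply, hen]
    simp only [RCLike.ofReal_real_eq_id, id, one_pow, div_one]
    module
  have hj : ∀ j, (fderiv ℝ (fderiv ℝ u₁) x (b j) (b j) / u₁ x - (fderiv ℝ u₁ x (b j) / u₁ x) ^ 2)
      + (fderiv ℝ (fderiv ℝ u₂) y (w j) (w j) / u₂ y - (fderiv ℝ u₂ y (w j) / u₂ y) ^ 2)
      + (4 * β * ⟪e, b j⟫ ^ 2 / (r + ε) ^ 2 + (-2 * ‖b j‖ ^ 2 + -2 * ‖w j‖ ^ 2)) ≤ 0 := by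
    intro j
    have hs := ((hasSecond_log h1open hs1 hp1 hx (b j)).add
      (hasSecond_log h2open hs2 hp2 hy (w j))).add
      ((hasSecond_neglog β (s := r + ε) (by positivity) ⟪e, b j⟫).add
      ((hasSecond_quad a x (b j) ε).add (hasSecond_quad a y (w j) ε)))
    refine hs.nonpos ?_
    have hc : Filter.Tendsto (fun t : ℝ => (x + t • b j, y + t • w j)) (nhds 0)
        (nhds (x, y)) := by
      have := Continuous.tendsto (f := fun t : ℝ => (x + t • b j, y + t • w j)) (by fun_prop) 0
      simpa using this
    have hpos : ∀ᶠ t : ℝ in nhds 0, 0 < r + 2 * t * ⟪e, b j⟫ := by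
      have := Continuous.tendsto (f := fun t : ℝ => r + 2 * t * ⟪e, b j⟫) (by fun_prop) 0
      refine this.eventually (lt_mem_nhds ?_)
      simpa using hr
    filter_upwards [hc.eventually hmax, hpos] with t ht htp
    have hnorm : ‖(x + t • b j) - (y + t • w j)‖ = r + 2 * t * ⟪e, b j⟫ := by
      have : (x + t • b j) - (y + t • w j) = (r + 2 * t * ⟪e, b j⟫) • e := by
        rw [hw, add_smul, ← hxe]
        module
      rw [this, norm_smul, hen, Real.norm_of_nonneg htp.le, mul_one]
    unfold bigW psi at ht
    simp only [hnorm] at ht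
    simp only [zero_smul, add_zero, mul_zero, zero_mul]
    rw [show r + ε + 2 * t * ⟪e, b j⟫ = r + 2 * t * ⟪e, b j⟫ + ε by ring]
    linarith
  have hsum := Finset.sum_nonpos fun j (_ : j ∈ Finset.univ) => hj j
  have hb1 : ∀ j, ‖b j‖ = 1 := fun j => b.orthonormal.1 j
  have hw1 : ∀ j, ‖w j‖ = 1 := fun j => w.orthonormal.1 j
  have hg1 := log_gradient_eq h1open hs1 hp1 hε hxy hx hm1 b
  have hg2 := log_gradient_eq h2open hs2 hp2 hε hxy.symm hy hm2 w
  have hL1 := lapl_eq h1open hs1 hx b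
  have hL2 := lapl_eq h2open hs2 hy w
  rw [hl1 x hx] at hL1
  rw [hl2 y hy] at hL2
  have hc := b.sum_sq_inner_left e
  simp only [Finset.sum_add_distrib, Finset.sum_sub_distrib, ← Finset.sum_div, ← Finset.mul_sum,
    hb1, hw1, hL1, hL2, hg1, hg2, hc, hen, zero_div, one_pow, mul_one, Finset.sum_const,
    Finset.card_univ, Fintype.card_fin, nsmul_eq_mul] at hsum
  linarith

theorem psiG_bound {E : Type*} [NormedAddCommGroup E] [InnerProductSpace ℝ E] {a x y : E}
    {ε β : ℝ} (hε : 0 < ε) (hβ : 0 ≤ β) (ha : ‖a‖ ≤ 1) (hxy : x ≠ y) :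
    ‖psiG a ε β y x‖ ^ 2 + ‖psiG a ε β x y‖ ^ 2 ≤
      2 * β ^ 2 / (‖x - y‖ + ε) ^ 2 + 4 * β + 8 * (‖x‖ ^ 2 + ‖y‖ ^ 2) + 4 * ε ^ 2 := by
  have hr : 0 < ‖x - y‖ := norm_pos_iff.2 (sub_ne_zero.2 hxy)
  unfold psiG
  rw [norm_sub_rev y x]
  set r := ‖x - y‖ with hrdef
  set k := β / (r + ε) / r with hk
  set P := (2 : ℝ) • x - ε • a with hP
  set Q := (2 : ℝ) • y - ε • a with hQ
  have h1 : -(k • (x - y)) - (2 : ℝ) • x + ε • a = -(k • (x - y) + P) := by rw [hP]; module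
  have h2 : -(k • (y - x)) - (2 : ℝ) • y + ε • a = k • (x - y) - Q := by rw [hQ]; module
  have h3 : ⟪x - y, P⟫ - ⟪x - y, Q⟫ = 2 * r ^ 2 := by
    rw [← inner_sub_right, show P - Q = (2 : ℝ) • (x - y) by rw [hP, hQ]; module,
      inner_smul_right, real_inner_self_eq_norm_sq]
  have hb : ∀ z : E, ‖(2 : ℝ) • z - ε • a‖ ^ 2 ≤ 8 * ‖z‖ ^ 2 + 2 * ε ^ 2 := by
    intro z
    have h4 : ‖(2 : ℝ) • z - ε • a‖ ≤ 2 * ‖z‖ + ε := by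
      refine (norm_sub_le _ _).trans ?_
      rw [norm_smul, norm_smul, Real.norm_of_nonneg hε.le, Real.norm_two]
      nlinarith
    have h5 := pow_le_pow_left₀ (norm_nonneg _) h4 2
    nlinarith [sq_nonneg (2 * ‖z‖ - ε)]
  have hPb := hb x
  have hQb := hb y
  rw [← hP] at hPb
  rw [← hQ] at hQb
  clear_value P Q
  rw [h1, h2, norm_neg, norm_add_sq_real, norm_sub_sq_real, norm_smul, mul_pow, ← hrdef,
    Real.norm_eq_abs, sq_abs, real_inner_smul_left, real_inner_smul_left]
  have h6 : k ^ 2 * r ^ 2 = β ^ 2 / (r + ε) ^ 2 := by rw [hk]; field_simp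
  have h7 : k * r ^ 2 ≤ β := by
    have : k * r ^ 2 = β * (r / (r + ε)) := by rw [hk]; field_simp
    rw [this]
    refine mul_le_of_le_one_right hβ ?_
    rw [div_le_one (by positivity)]; linarith
  rw [h6, mul_div_assoc]
  have h8 : k * ⟪x - y, P⟫ - k * ⟪x - y, Q⟫ = 2 * (k * r ^ 2) := by
    rw [← mul_sub, h3]; ring
  linarith

theorem radial {r ε β ρ c : ℝ} (hr : 0 ≤ r) (hε : 0 < ε)
    (h : ∀ t : ℝ, 0 < t → t ≤ 1 →
      β * Real.log t - β * Real.log (t * r + ε) - t ^ 2 * ρ + t * c ≤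
        - β * Real.log (r + ε) - ρ + c) :
    2 * ρ ≤ β * ε / (r + ε) + c := by
  set f : ℝ → ℝ := fun t => β * Real.log t - β * Real.log (t * r + ε) - t ^ 2 * ρ + t * c
  have h1 : HasDerivAt f (β * (1 / 1) - β * (r / (1 * r + ε)) - 2 * ρ + c) 1 := by
    have ha := ((hasDerivAt_id (1 : ℝ)).log one_ne_zero).const_mul β
    have hb := ((((hasDerivAt_id (1 : ℝ)).mul_const r).add_const ε).log
      (by simp; positivity)).const_mul β
    have hc := ((hasDerivAt_id (1 : ℝ)).pow 2).mul_const ρ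
    have hd := (hasDerivAt_id (1 : ℝ)).mul_const c
    refine (((ha.sub hb).sub hc).add hd).congr_deriv ?_
    simp
  have hmax : IsLocalMaxOn f (Iic 1) 1 := by
    have : ∀ᶠ t : ℝ in nhdsWithin 1 (Iic 1), 0 < t :=
      mem_nhdsWithin_of_mem_nhds (lt_mem_nhds one_pos)
    filter_upwards [this, self_mem_nhdsWithin] with t h0 ht1
    have := h t h0 ht1
    simp only [f, Real.log_one]
    simp only [one_mul, one_pow]
    linarith
  have h2 := hmax.hasFDerivWithinAt_nonpos (h1.hasFDerivAt.hasFDerivWithinAt) (y := -1) (by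
    apply mem_posTangentConeAt_of_segment_subset
    rw [segment_symm, segment_eq_Icc (by norm_num)]
    exact fun z hz => hz.2)
  simp at h2
  have h3 : β - β * (r / (r + ε)) = β * ε / (r + ε) := by
    have : r + ε ≠ 0 := by positivity
    field_simp; ring
  linarith

theorem cone_small {n : ℕ} {Γ : Set (EuclideanSpace ℝ (Fin n))} (hne : Γ.Nonempty)
    (hc : IsConeSet Γ) : ∃ x ∈ Γ, ‖x‖ ≤ 1 := by
  obtain ⟨z, hz⟩ := hne
  refine ⟨(1 + ‖z‖)⁻¹ • z, hc z hz _ (by positivity), ?_⟩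
  rw [norm_smul, norm_inv, Real.norm_of_nonneg (by positivity), inv_mul_le_iff₀ (by positivity)]
  linarith

theorem cone_closure {n : ℕ} {Γ : Set (EuclideanSpace ℝ (Fin n))}
    (hc : IsConeSet Γ) {x : EuclideanSpace ℝ (Fin n)} (hx : x ∈ closure Γ) {l : ℝ} (hl : 0 < l) :
    l • x ∈ closure Γ := by
  have hcont : Continuous fun z : EuclideanSpace ℝ (Fin n) => l • z := by fun_prop
  exact map_mem_closure hcont hx fun z hz => hc z hz l hl

/-- Existence of the maximum of the two-point functional. -/
theorem exists_max {n : ℕ} {Γ₁ Γ₂ : Set (EuclideanSpace ℝ (Fin n))}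
    (h1ne : Γ₁.Nonempty) (h2ne : Γ₂.Nonempty) (h1cone : IsConeSet Γ₁) (h2cone : IsConeSet Γ₂)
    {u₁ u₂ : EuclideanSpace ℝ (Fin n) → ℝ}
    (hc1 : ContinuousOn u₁ (closure Γ₁)) (hc2 : ContinuousOn u₂ (closure Γ₂))
    (hp1 : ∀ x ∈ Γ₁, 0 < u₁ x) (hp2 : ∀ x ∈ Γ₂, 0 < u₂ x)
    (hn1 : ∀ x ∈ closure Γ₁, 0 ≤ u₁ x)
    (a : EuclideanSpace ℝ (Fin n)) {ε : ℝ} (hε : 0 < ε) (β : ℝ) :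
    ∃ x ∈ closure Γ₁, ∃ y ∈ closure Γ₂, 0 < u₁ x ∧ 0 < u₂ y ∧ ‖x‖ ^ 2 + ‖y‖ ^ 2 ≤ 4 ∧
      ∀ x' ∈ closure Γ₁, ∀ y' ∈ closure Γ₂, 0 < u₁ x' → 0 < u₂ y' → ‖x'‖ ^ 2 + ‖y'‖ ^ 2 ≤ 4 →
        bigW u₁ u₂ a ε β x' y' ≤ bigW u₁ u₂ a ε β x y := by
  set G : EuclideanSpace ℝ (Fin n) × EuclideanSpace ℝ (Fin n) → ℝ := fun p => psi a ε β p.2 p.1 + (-‖p.2‖ ^ 2 + ε * ⟪a, p.2⟫) with hG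
  have hGc : Continuous G := by
    have hl : Continuous fun p : EuclideanSpace ℝ (Fin n) × EuclideanSpace ℝ (Fin n) => Real.log (‖p.1 - p.2‖ + ε) :=
      Continuous.log (by fun_prop) fun p => by positivity
    simp only [hG, psi]
    fun_prop
  set K : Set (EuclideanSpace ℝ (Fin n) × EuclideanSpace ℝ (Fin n)) := (closure Γ₁ ×ˢ closure Γ₂) ∩ {p | ‖p.1‖ ^ 2 + ‖p.2‖ ^ 2 ≤ 4} with hK
  have hKc : IsCompact K := by
    refine Metric.isCompact_of_isClosed_isBounded ?_ ?_
    · exact (isClosed_closure.prod isClosed_closure).inter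
        (isClosed_le (by fun_prop) continuous_const)
    · refine (Metric.isBounded_closedBall (x := (0 : EuclideanSpace ℝ (Fin n) × EuclideanSpace ℝ (Fin n))) (r := 2)).subset ?_
      rintro ⟨p, q⟩ ⟨_, hpq⟩
      simp only [mem_ofPred_eq] at hpq
      rw [mem_closedBall_zero_iff, Prod.norm_def]
      refine max_le ?_ ?_
      · exact abs_le_of_sq_le_sq' (by nlinarith [sq_nonneg ‖q‖]) (by norm_num) |>.2
      · exact abs_le_of_sq_le_sq' (by nlinarith [sq_nonneg ‖p‖]) (by norm_num) |>.2
  set F : EuclideanSpace ℝ (Fin n) × EuclideanSpace ℝ (Fin n) → ℝ := fun p => u₁ p.1 * u₂ p.2 * Real.exp (G p) with hF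
  have hFc : ContinuousOn F K := by
    refine ContinuousOn.mul (ContinuousOn.mul ?_ ?_) ?_
    · exact hc1.comp continuousOn_fst fun p hp => hp.1.1
    · exact hc2.comp continuousOn_snd fun p hp => hp.1.2
    · exact (Real.continuous_exp.comp hGc).continuousOn
  obtain ⟨x0, hx0, hx0n⟩ := cone_small h1ne h1cone
  obtain ⟨y0, hy0, hy0n⟩ := cone_small h2ne h2cone
  have h0K : (x0, y0) ∈ K := by
    refine ⟨⟨subset_closure hx0, subset_closure hy0⟩, ?_⟩
    simp only [mem_ofPred_eq]
    nlinarith [norm_nonneg x0, norm_nonneg y0]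
  obtain ⟨⟨x, y⟩, hxyK, hmax⟩ := hKc.exists_isMaxOn ⟨_, h0K⟩ hFc
  have hpos : 0 < F (x, y) := by
    refine lt_of_lt_of_le ?_ (hmax h0K)
    have := hp1 _ hx0
    have := hp2 _ hy0
    simp only [hF]
    positivity
  have hx := hxyK.1.1
  have hy := hxyK.1.2
  have hprod : 0 < u₁ x * u₂ y := by
    simp only [hF] at hpos
    exact (pos_iff_pos_of_mul_pos hpos).2 (Real.exp_pos _)
  have hu1 : 0 < u₁ x := lt_of_le_of_ne (hn1 x hx) fun h => by rw [← h] at hprod; simp at hprod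
  have hu2 : 0 < u₂ y := (pos_iff_pos_of_mul_pos hprod).1 hu1
  have hlog : ∀ p q : EuclideanSpace ℝ (Fin n), 0 < u₁ p → 0 < u₂ q → Real.log (F (p, q)) = bigW u₁ u₂ a ε β p q := by
    intro p q hp hq
    simp only [hF, bigW]
    rw [Real.log_mul (by positivity) (Real.exp_pos _).ne', Real.log_mul hp.ne' hq.ne',
      Real.log_exp]
  refine ⟨x, hx, y, hy, hu1, hu2, hxyK.2, ?_⟩
  intro x' hx' y' hy' hux hvy hn
  rw [← hlog _ _ hux hvy, ← hlog _ _ hu1 hu2]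
  refine Real.log_le_log ?_ (hmax ⟨⟨hx', hy'⟩, hn⟩)
  simp only [hF]
  positivity

theorem final_arith {n β ε r ρ c K : ℝ} (hn : 0 ≤ n) (hβ : 0 < β) (hβ2 : β < 2) (hr : 0 ≤ r)
    (hKd : K = (4 * n + 44) / (2 * β * (2 - β)))
    (hε : 0 < ε) (hε1 : ε ≤ 1) (hεK : ε * ((8 * K + 26) * (K + 1)) ≤ 1)
    (hρ : ρ ≤ 4) (hrρ : r ^ 2 ≤ 2 * ρ) (hc : c ≤ 4)
    (h1 : 2 * ρ ≤ β * ε / (r + ε) + ε * c)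
    (h2 : 4 * β / (r + ε) ^ 2 ≤ 2 * β ^ 2 / (r + ε) ^ 2 + 4 * β + 8 * ρ + 4 * ε ^ 2 + 4 * n) :
    False := by
  have hs : 0 < r + ε := by positivity
  set s := r + ε with hsd
  have hb : 0 < 2 * β * (2 - β) := by have : 0 < 2 - β := by linarith
                                      positivity
  have hK0 : 0 < K := by rw [hKd]; positivity
  have h3 : 1 ≤ K * s ^ 2 := by
    have h4 : 2 * β * (2 - β) / s ^ 2 ≤ 4 * n + 44 := by
      have : 2 * β * (2 - β) / s ^ 2 = 4 * β / s ^ 2 - 2 * β ^ 2 / s ^ 2 := by ring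
      rw [this]
      nlinarith
    rw [div_le_iff₀ (by positivity)] at h4
    rw [hKd, div_mul_eq_mul_div, le_div_iff₀ hb]
    linarith
  have h5 : 1 / s ≤ K + 1 := by
    rw [div_le_iff₀ hs]
    by_contra! hc
    have hs1 : s < 1 := by nlinarith
    nlinarith
  have h6 : β * ε / s ≤ 2 * ε * (K + 1) := by
    have : β * ε / s = β * ε * (1 / s) := by ring
    rw [this]
    have : 0 < 1 / s := by positivity
    have : β * ε ≤ 2 * ε := by nlinarith
    gcongr
  have h7 : 2 * ρ ≤ ε * (2 * K + 6) := by nlinarith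
  have h8 : s ^ 2 ≤ ε * (4 * K + 14) := by
    rw [hsd]
    nlinarith [sq_nonneg (r - ε)]
  have h9 : K * s ^ 2 ≤ K * (ε * (4 * K + 14)) := by gcongr
  have h10 : K * (ε * (4 * K + 14)) < ε * ((8 * K + 26) * (K + 1)) := by
    have : 0 < ε * ((8 * K + 26) * (K + 1) - K * (4 * K + 14)) := by
      apply mul_pos hε; nlinarith
    linarith
  linarith

/-- Friedland–Hayman inequality for convex cones. -/
theorem friedland_hayman_convex_cones {n : ℕ} (hn : 2 ≤ n)
    (Γ Γ₁ Γ₂ : Set (EuclideanSpace ℝ (Fin n)))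
    (hΓopen : IsOpen Γ) (hΓconv : Convex ℝ Γ) (hΓne : Γ.Nonempty) (hΓcone : IsConeSet Γ)
    (h1open : IsOpen Γ₁) (h2open : IsOpen Γ₂)
    (h1ne : Γ₁.Nonempty) (h2ne : Γ₂.Nonempty)
    (h1cone : IsConeSet Γ₁) (h2cone : IsConeSet Γ₂)
    (hdisj : Disjoint Γ₁ Γ₂) (h1sub : Γ₁ ⊆ Γ) (h2sub : Γ₂ ⊆ Γ)
    (u₁ u₂ : EuclideanSpace ℝ (Fin n) → ℝ) (α₁ α₂ : ℝ)
    (hα₁ : 0 < α₁) (hα₂ : 0 < α₂)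
    (hu₁ : FHData Γ Γ₁ u₁ α₁) (hu₂ : FHData Γ Γ₂ u₂ α₂) :
    2 ≤ α₁ + α₂ := by
  by_contra! hβ2
  set β := α₁ + α₂ with hβd
  have hβ : 0 < β := by positivity
  obtain ⟨a, haΓ, ha1⟩ := cone_small hΓne hΓcone
  set K : ℝ := (4 * (n : ℝ) + 44) / (2 * β * (2 - β)) with hK
  have hK0 : 0 < K := by
    have : 0 < 2 - β := by linarith
    positivity
  set ε : ℝ := 1 / ((8 * K + 26) * (K + 1)) with hεd
  have hε : 0 < ε := by positivity
  have hεK : ε * ((8 * K + 26) * (K + 1)) ≤ 1 := by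
    rw [hεd, one_div, inv_mul_cancel₀ (by positivity)]
  have hε1 : ε ≤ 1 := by
    rw [hεd, div_le_one (by positivity)]
    nlinarith
  have hn1 : ∀ x ∈ closure Γ₁, 0 ≤ u₁ x := by
    intro x hx
    have hm := (hu₁.cont x hx).mono subset_closure
    have : (nhdsWithin x Γ₁).NeBot := mem_closure_iff_nhdsWithin_neBot.1 hx
    refine ge_of_tendsto hm ?_
    filter_upwards [self_mem_nhdsWithin] with z hz using (hu₁.pos z hz).le
  obtain ⟨x, hx, y, hy, hux, huy, hnorm, hmax⟩ :=
    exists_max h1ne h2ne h1cone h2cone hu₁.cont hu₂.cont hu₁.pos hu₂.pos hn1 a hε β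
  have hxy : x ≠ y := by
    rintro rfl
    obtain ⟨δ, hδ, hsub⟩ := localSub hΓconv h1open h1sub hu₁.cont hu₁.dirichlet hx hux
    obtain ⟨z, hz, hzd⟩ := Metric.mem_closure_iff.1 hy δ hδ
    exact hdisj.le_bot ⟨hsub ⟨h2sub hz, by rwa [Metric.mem_ball']⟩, hz⟩
  have hcle : ⟪a, x + y⟫ ≤ ‖x‖ + ‖y‖ := by
    refine (real_inner_le_norm _ _).trans ?_
    refine (mul_le_of_le_one_left (norm_nonneg _) ha1).trans (norm_add_le _ _)
  have hr2 : ‖x - y‖ ^ 2 ≤ 2 * (‖x‖ ^ 2 + ‖y‖ ^ 2) := by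
    have := pow_le_pow_left₀ (norm_nonneg _) (norm_sub_le x y) 2
    nlinarith [sq_nonneg (‖x‖ - ‖y‖)]
  have hrad : 2 * (‖x‖ ^ 2 + ‖y‖ ^ 2) ≤ β * ε / (‖x - y‖ + ε) + ε * ⟪a, x + y⟫ := by
    refine radial (norm_nonneg _) hε ?_
    intro t ht0 ht1
    have hpx := hu₁.homog t ht0 x hx
    have hpy := hu₂.homog t ht0 y hy
    have htp1 : 0 < t ^ α₁ := Real.rpow_pos_of_pos ht0 _
    have htp2 : 0 < t ^ α₂ := Real.rpow_pos_of_pos ht0 _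
    have htn : ∀ z : EuclideanSpace ℝ (Fin n), ‖t • z‖ = t * ‖z‖ := fun z => by
      rw [norm_smul, Real.norm_of_nonneg ht0.le]
    have ht2 : t ^ 2 ≤ 1 := pow_le_one₀ ht0.le ht1
    have := hmax (t • x) (cone_closure h1cone hx ht0) (t • y) (cone_closure h2cone hy ht0)
      (by rw [hpx]; positivity) (by rw [hpy]; positivity)
      (by rw [htn, htn]; nlinarith [sq_nonneg ‖x‖, sq_nonneg ‖y‖])
    unfold bigW psi at this
    rw [hpx, hpy, ← smul_sub, htn, htn, htn, Real.log_mul htp1.ne' hux.ne',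
      Real.log_mul htp2.ne' huy.ne', Real.log_rpow ht0, Real.log_rpow ht0, inner_smul_right,
      inner_smul_right] at this
    rw [inner_add_right, hβd] at *
    linarith
  -- the maximum is not on the outer sphere
  have hlt : ‖x‖ ^ 2 + ‖y‖ ^ 2 < 4 := by
    have h1 : β * ε / (‖x - y‖ + ε) ≤ 2 := by
      rw [div_le_iff₀ (by positivity)]
      nlinarith [norm_nonneg (x - y)]
    have h2 : ε * ⟪a, x + y⟫ ≤ ‖x‖ + ‖y‖ := by
      have h0 : 0 ≤ ‖x‖ + ‖y‖ := by positivity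
      nlinarith
    nlinarith [sq_nonneg (‖x‖ - 1), sq_nonneg (‖y‖ - 1)]
  have hnear : ∀ᶠ p : EuclideanSpace ℝ (Fin n) × EuclideanSpace ℝ (Fin n) in nhds (x, y), ‖p.1‖ ^ 2 + ‖p.2‖ ^ 2 < 4 :=
    (Continuous.tendsto (f := fun p : EuclideanSpace ℝ (Fin n) × EuclideanSpace ℝ (Fin n) => ‖p.1‖ ^ 2 + ‖p.2‖ ^ 2) (by fun_prop)
      (x, y)).eventually (gt_mem_nhds hlt)
  have hc1 : Filter.Tendsto (fun z : EuclideanSpace ℝ (Fin n) => (z, y)) (nhds x) (nhds (x, y)) :=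
    Continuous.tendsto (by fun_prop) x
  have hc2 : Filter.Tendsto (fun z : EuclideanSpace ℝ (Fin n) => (x, z)) (nhds y) (nhds (x, y)) :=
    Continuous.tendsto (by fun_prop) y
  have hx1 : x ∈ Γ₁ := by
    refine boundary hΓopen hΓconv hΓcone h1open h1sub hα₁ hu₁ hε hβ.le haΓ
      (closure_mono h2sub hy) hxy hx hux ?_
    have hpos := (hu₁.cont x hx).eventually (lt_mem_nhds hux)
    filter_upwards [mem_nhdsWithin_of_mem_nhds (hc1.eventually hnear), hpos,
      self_mem_nhdsWithin] with z hz1 hz2 hz3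
    have := hmax z hz3 y hy hz2 huy hz1.le
    unfold bigW at this
    linarith
  have hy2 : y ∈ Γ₂ := by
    refine boundary hΓopen hΓconv hΓcone h2open h2sub hα₂ hu₂ hε hβ.le haΓ
      (closure_mono h1sub hx) hxy.symm hy huy ?_
    have hpos := (hu₂.cont y hy).eventually (lt_mem_nhds huy)
    filter_upwards [mem_nhdsWithin_of_mem_nhds (hc2.eventually hnear), hpos,
      self_mem_nhdsWithin] with z hz1 hz2 hz3
    have := hmax x hx z hz3 hux hz2 hz1.le
    unfold bigW at this
    rw [psi_symm a ε β x z, psi_symm a ε β x y] at this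
    linarith
  have hint := interior_ineq h1open h2open hu₁.smooth hu₁.pos hu₁.harmonic hu₂.smooth hu₂.pos
    hu₂.harmonic (a := a) (β := β) hε hxy hx1 hy2 (by
      have hm : ∀ᶠ p : EuclideanSpace ℝ (Fin n) × EuclideanSpace ℝ (Fin n) in nhds (x, y), p ∈ Γ₁ ×ˢ Γ₂ :=
        (h1open.prod h2open).mem_nhds ⟨hx1, hy2⟩
      filter_upwards [hnear, hm] with p hp1 hp2
      exact hmax p.1 (subset_closure hp2.1) p.2 (subset_closure hp2.2) (hu₁.pos _ hp2.1)
        (hu₂.pos _ hp2.2) hp1.le)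
  have hG := psiG_bound (x := x) (y := y) hε hβ.le ha1 hxy
  refine final_arith (n := (n : ℝ)) (c := ⟪a, x + y⟫) (by positivity) hβ hβ2 (norm_nonneg (x - y))
    hK hε hε1 hεK hlt.le hr2 ?_ hrad (by linarith)
  nlinarith [sq_nonneg (‖x‖ - 1), sq_nonneg (‖y‖ - 1)]
end
end

section
/- Construction of a convex function violating the Dini condition (Proposition 7.7): For every C₁* ≥ 0 there exist a bounded convex function f defined on the closed ball B̄_{1/2} ⊆ ℝ² with f(0) = 0 and f ≥ 0, and a constant c* > 0, with the following properties. (i) For every unit vector θ ∈ 𝕊¹, lim_{t→0⁺} f(tθ)/t = C₁*. (ii) For every t ∈ (0, 1/2), sup_{θ ∈ 𝕊¹} N(t,θ) ≥ c*·t/log(1/t), where N(t,θ) := t·f′⁺(t,θ) − f(tθ) and f′⁺(t,θ) is the right derivative at s = t of the convex function s ↦ f(sθ). In particular, ∫_δ^{1/2} t⁻²·sup_{θ} N(t,θ) dt → ∞ as δ → 0⁺. -/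
open Set MeasureTheory

noncomputable section

/-- `N(t,θ) = t·f′⁺(t,θ) − f(tθ)`, where `f′⁺(t,θ)` is the right derivative at `s = t`
of the convex function `s ↦ f(sθ)`, rendered as the derivative within `Ici t`. -/
noncomputable def Nrad (f : EuclideanSpace ℝ (Fin 2) → ℝ) (t : ℝ)
    (θ : EuclideanSpace ℝ (Fin 2)) : ℝ :=
  t * derivWithin (fun s : ℝ => f (s • θ)) (Ici t) t - f (t • θ)

abbrev E2 := EuclideanSpace ℝ (Fin 2)

/-- supremum of the positive parts of affine functions -/
def hsup {ι : Type} (a : ι → E2) (b : ι → ℝ) (x : E2) : ℝ :=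
  ⨆ p : ι, max 0 (inner ℝ (a p) x - b p)

section hs
variable {ι : Type} [Nonempty ι] {a : ι → E2} {b : ι → ℝ}

lemma term_le (ha : ∀ p, ‖a p‖ ≤ 1) (hb : ∀ p, 0 < b p) (x : E2) (p : ι) :
    max 0 (inner ℝ (a p) x - b p) ≤ ‖x‖ := by
  apply max_le (norm_nonneg _)
  have h1 := real_inner_le_norm (a p) x
  have h2 := mul_le_mul_of_nonneg_right (ha p) (norm_nonneg x)
  have := hb p
  linarith

lemma hsup_bdd (ha : ∀ p, ‖a p‖ ≤ 1) (hb : ∀ p, 0 < b p) (x : E2) :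
    BddAbove (range fun p : ι => max 0 (inner ℝ (a p) x - b p)) :=
  ⟨‖x‖, by rintro _ ⟨p, rfl⟩; exact term_le ha hb x p⟩

lemma hsup_ge (ha : ∀ p, ‖a p‖ ≤ 1) (hb : ∀ p, 0 < b p) (x : E2) (p : ι) :
    inner ℝ (a p) x - b p ≤ hsup a b x :=
  (le_max_right _ _).trans (le_ciSup (hsup_bdd ha hb x) p)

lemma hsup_nonneg (x : E2) : 0 ≤ hsup a b x :=
  Real.iSup_nonneg fun _ => le_max_left _ _

lemma hsup_le {x : E2} {c : ℝ} (hc : 0 ≤ c) (h : ∀ p, inner ℝ (a p) x - b p ≤ c) :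
    hsup a b x ≤ c := ciSup_le fun p => max_le hc (h p)

lemma hsup_le_norm (ha : ∀ p, ‖a p‖ ≤ 1) (hb : ∀ p, 0 < b p) (x : E2) :
    hsup a b x ≤ ‖x‖ := ciSup_le fun p => term_le ha hb x p

lemma hsup_zero (ha : ∀ p, ‖a p‖ ≤ 1) (hb : ∀ p, 0 < b p) : hsup a b 0 = 0 :=
  le_antisymm (by simpa using hsup_le_norm ha hb 0) (hsup_nonneg 0)

lemma hsup_convex (ha : ∀ p, ‖a p‖ ≤ 1) (hb : ∀ p, 0 < b p) :
    ConvexOn ℝ univ (hsup a b) := by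
  refine ⟨convex_univ, ?_⟩
  intro x _ y _ u v hu hv huv
  simp only [smul_eq_mul]
  apply hsup_le
  · have := hsup_nonneg (a := a) (b := b) x
    have := hsup_nonneg (a := a) (b := b) y
    positivity
  · intro p
    have h1 := mul_le_mul_of_nonneg_left (hsup_ge ha hb x p) hu
    have h2 := mul_le_mul_of_nonneg_left (hsup_ge ha hb y p) hv
    rw [inner_add_right, inner_smul_right, inner_smul_right]
    have : b p = u * b p + v * b p := by rw [← add_mul, huv, one_mul]
    linarith

lemma hsup_lip (ha : ∀ p, ‖a p‖ ≤ 1) (hb : ∀ p, 0 < b p) (x y : E2) :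
    hsup a b x ≤ hsup a b y + ‖x - y‖ := by
  apply hsup_le
  · have := hsup_nonneg (a := a) (b := b) y
    positivity
  · intro p
    have h1 := hsup_ge ha hb y p
    have h2 := real_inner_le_norm (a p) (x - y)
    have h3 := mul_le_mul_of_nonneg_right (ha p) (norm_nonneg (x - y))
    rw [inner_sub_right] at h2
    linarith

lemma hsup_tendsto (ha : ∀ p, ‖a p‖ ≤ 1) (hb : ∀ p, 0 < b p)
    (hfin : ∀ ε > 0, {p | ε < ‖a p‖}.Finite) (θ : E2) (hθ : ‖θ‖ = 1) :
    Filter.Tendsto (fun t : ℝ => hsup a b (t • θ) / t) (nhdsWithin 0 (Ioi 0)) (nhds 0) := by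
  rw [Metric.tendsto_nhds]
  intro ε hε
  have h1 : ∀ᶠ t : ℝ in nhdsWithin 0 (Ioi 0), ∀ p ∈ {p | ε / 2 < ‖a p‖}, t < b p := by
    rw [Filter.eventually_all_finite (hfin _ (half_pos hε))]
    intro p _
    exact nhdsWithin_le_nhds (eventually_lt_nhds (hb p))
  filter_upwards [h1, self_mem_nhdsWithin] with t ht ht0
  have ht0 : 0 < t := ht0
  have h2 : hsup a b (t • θ) ≤ ε / 2 * t := by
    apply hsup_le (by positivity)
    intro p
    have h3 := real_inner_le_norm (a p) (t • θ)
    rw [norm_smul, hθ, Real.norm_of_nonneg ht0.le, mul_one] at h3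
    by_cases hp : ε / 2 < ‖a p‖
    · have := ht p hp
      have := mul_le_mul_of_nonneg_right (ha p) ht0.le
      have : 0 ≤ ε / 2 * t := by positivity
      linarith
    · have := mul_le_mul_of_nonneg_right (not_lt.1 hp) ht0.le
      have := hb p
      linarith
  rw [Real.dist_eq, sub_zero, abs_of_nonneg (div_nonneg (hsup_nonneg _) ht0.le), div_lt_iff₀ ht0]
  nlinarith

/-- the full function -/
def ffun (C : ℝ) (a : ι → E2) (b : ι → ℝ) (x : E2) : ℝ := C * ‖x‖ + ‖x‖ ^ 2 + hsup a b x

lemma ffun_convex {C : ℝ} (hC : 0 ≤ C) (ha : ∀ p, ‖a p‖ ≤ 1) (hb : ∀ p, 0 < b p) :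
    ConvexOn ℝ univ (ffun C a b) := by
  have h1 : ConvexOn ℝ univ (fun x : E2 => ‖x‖) := convexOn_norm convex_univ
  have h2 : ConvexOn ℝ univ (fun x : E2 => ‖x‖ ^ 2) :=
    h1.pow (fun x _ => norm_nonneg x) 2
  exact ((h1.smul hC).add h2).add (hsup_convex ha hb)

lemma ffun_line_convex {C : ℝ} (hC : 0 ≤ C) (ha : ∀ p, ‖a p‖ ≤ 1) (hb : ∀ p, 0 < b p) (θ : E2) :
    ConvexOn ℝ univ (fun s : ℝ => ffun C a b (s • θ)) := by
  have := (ffun_convex (C := C) hC ha hb).comp_linearMap (LinearMap.toSpanSingleton ℝ E2 θ)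
  simpa [Function.comp_def] using this

lemma slope_tendsto {g : ℝ → ℝ} (hg : ConvexOn ℝ univ g) (t : ℝ) :
    Filter.Tendsto (slope g t) (nhdsWithin t (Ioi t)) (nhds (derivWithin g (Ici t) t)) := by
  have h := hg.differentiableWithinAt_Ioi_of_mem_interior (x := t) (by simp)
  have h' := (differentiableWithinAt_Ioi_iff_Ici.1 h).hasDerivWithinAt
  exact (hasDerivWithinAt_iff_tendsto_slope' self_notMem_Ioi).1 h'.Ioi_of_Ici

lemma ffun_line {C : ℝ} {θ : E2} (hθ : ‖θ‖ = 1) {s : ℝ} (hs : 0 ≤ s) :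
    ffun C a b (s • θ) = C * s + s ^ 2 + hsup a b (s • θ) := by
  simp [ffun, norm_smul, hθ, abs_of_nonneg hs]

lemma Nrad_bdd {C : ℝ} (hC : 0 ≤ C) (ha : ∀ p, ‖a p‖ ≤ 1) (hb : ∀ p, 0 < b p)
    {t : ℝ} (ht : t ∈ Ioo (0:ℝ) (1/2)) :
    BddAbove {r : ℝ | ∃ θ : E2, ‖θ‖ = 1 ∧ r = Nrad (ffun C a b) t θ} := by
  refine ⟨t * (C + 3), ?_⟩
  rintro _ ⟨θ, hθ, rfl⟩
  obtain ⟨ht0, ht1⟩ := ht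
  have hD : derivWithin (fun s : ℝ => ffun C a b (s • θ)) (Ici t) t ≤ C + 3 := by
    apply le_of_tendsto (slope_tendsto (ffun_line_convex hC ha hb θ) t)
    filter_upwards [Ioo_mem_nhdsGT (show t < 1 by linarith)] with s hs
    obtain ⟨hs0, hs1⟩ := hs
    rw [slope_def_field, div_le_iff₀ (by linarith), ffun_line hθ (by linarith),
      ffun_line hθ ht0.le]
    have h := hsup_lip ha hb (s • θ) (t • θ)
    rw [← sub_smul, norm_smul, hθ, Real.norm_of_nonneg (by linarith)] at h
    nlinarith
  have h0 : 0 ≤ ffun C a b (t • θ) := by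
    rw [ffun_line hθ ht0.le]
    have := hsup_nonneg (a := a) (b := b) (t • θ)
    positivity
  unfold Nrad
  have := mul_le_mul_of_nonneg_left hD ht0.le
  linarith

lemma Nrad_lower {C : ℝ} (hC : 0 ≤ C) (ha : ∀ p, ‖a p‖ ≤ 1) (hb : ∀ p, 0 < b p)
    {t : ℝ} (ht0 : 0 < t) {θ : E2} (hθ : ‖θ‖ = 1) {v : ℝ}
    (hv : ∀ s, t ≤ s → hsup a b (t • θ) + v * (s - t) ≤ hsup a b (s • θ)) :
    t ^ 2 + t * v - hsup a b (t • θ) ≤ Nrad (ffun C a b) t θ := by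
  have hD : C + 2 * t + v ≤ derivWithin (fun s : ℝ => ffun C a b (s • θ)) (Ici t) t := by
    apply ge_of_tendsto (slope_tendsto (ffun_line_convex hC ha hb θ) t)
    filter_upwards [self_mem_nhdsWithin] with s hs
    have hs : t < s := hs
    rw [slope_def_field, le_div_iff₀ (by linarith), ffun_line hθ (by linarith),
      ffun_line hθ ht0.le]
    have := hv s hs.le
    nlinarith
  unfold Nrad
  rw [ffun_line hθ ht0.le]
  have := mul_le_mul_of_nonneg_left hD ht0.le
  nlinarith

lemma Nrad_lower_sq {C : ℝ} (hC : 0 ≤ C) (ha : ∀ p, ‖a p‖ ≤ 1) (hb : ∀ p, 0 < b p)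
    {t : ℝ} (ht0 : 0 < t) {θ : E2} (hθ : ‖θ‖ = 1) :
    t ^ 2 ≤ Nrad (ffun C a b) t θ := by
  have h := Nrad_lower (v := hsup a b (t • θ) / t) hC ha hb ht0 hθ ?_
  · have : t * (hsup a b (t • θ) / t) = hsup a b (t • θ) := by field_simp
    linarith
  · intro s hs
    have hs0 : 0 < s := by linarith
    have h := (hsup_convex ha hb).2 (mem_univ (s • θ)) (mem_univ (0 : E2))
      (show 0 ≤ t / s by positivity) (show 0 ≤ 1 - t / s by
        rw [sub_nonneg, div_le_one hs0]; exact hs) (by ring)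
    rw [hsup_zero ha hb, smul_zero, smul_zero, add_zero, add_zero, smul_smul,
      div_mul_cancel₀ _ hs0.ne', smul_eq_mul] at h
    have h2 : hsup a b (t • θ) + hsup a b (t • θ) / t * (s - t) = hsup a b (t • θ) * s / t := by
      field_simp; ring
    rw [h2, div_le_iff₀ ht0]
    rw [div_mul_eq_mul_div, le_div_iff₀ hs0] at h
    linarith

lemma Nrad_lower_active {C : ℝ} (hC : 0 ≤ C) (ha : ∀ p, ‖a p‖ ≤ 1) (hb : ∀ p, 0 < b p)
    {t : ℝ} (ht0 : 0 < t) {θ : E2} (hθ : ‖θ‖ = 1) (j : ι)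
    (h0 : 0 ≤ inner ℝ (a j) (t • θ) - b j)
    (hj : ∀ p, inner ℝ (a p) (t • θ) - b p ≤ inner ℝ (a j) (t • θ) - b j) :
    b j ≤ Nrad (ffun C a b) t θ := by
  have he : hsup a b (t • θ) = inner ℝ (a j) (t • θ) - b j :=
    le_antisymm (hsup_le h0 hj) (hsup_ge ha hb _ _)
  have h := Nrad_lower (v := inner ℝ (a j) θ) hC ha hb ht0 hθ ?_
  · rw [he, inner_smul_right] at h
    nlinarith
  · intro s hs
    have := hsup_ge ha hb (s • θ) j
    rw [he]
    rw [inner_smul_right] at this ⊢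
    linarith

end hs

lemma integral_top {c : ℝ} (hc : 0 < c) (F : ℝ → ℝ)
    (hF : ∀ t ∈ Ioo (0:ℝ) (1/2), c * (t / Real.log (1 / t)) ≤ F t) :
    ∫⁻ t in Ioo (0:ℝ) (1/2), ENNReal.ofReal (F t / t ^ 2) = ⊤ := by
  rw [eq_top_iff]
  set G : ℝ → ℝ := fun t => c * (t⁻¹ / Real.log (1 / t)) with hG
  have hlog : ∀ t ∈ Ioo (0:ℝ) (1/2), 0 < Real.log (1 / t) := by
    intro t ht
    apply Real.log_pos
    rw [lt_div_iff₀ ht.1]; linarith [ht.2]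
  have hle : ∫⁻ t in Ioo (0:ℝ) (1/2), ENNReal.ofReal (G t) ≤
      ∫⁻ t in Ioo (0:ℝ) (1/2), ENNReal.ofReal (F t / t ^ 2) := by
    apply setLIntegral_mono' measurableSet_Ioo
    intro t ht
    apply ENNReal.ofReal_le_ofReal
    have := ht.1
    rw [le_div_iff₀ (by positivity)]
    refine le_trans (le_of_eq ?_) (hF t ht)
    simp only [hG]
    have := hlog t ht
    field_simp
  refine le_trans ?_ hle
  rw [top_le_iff]
  by_contra hne
  have hmeas : AEStronglyMeasurable G (volume.restrict (Ioo (0:ℝ) (1/2))) := by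
    have : Measurable G := by
      simp only [hG]
      fun_prop
    exact this.aestronglyMeasurable
  have hint : IntegrableOn G (Ioo (0:ℝ) (1/2)) := by
    refine (lintegral_ofReal_ne_top_iff_integrable hmeas ?_).1 hne
    filter_upwards [ae_restrict_mem measurableSet_Ioo] with t ht
    have := hlog t ht
    have := ht.1
    simp only [hG, Pi.zero_apply]
    positivity
  have hd : ∀ t ∈ Ioo (0:ℝ) (1/2), HasDerivAt (fun t => Real.log (-Real.log t))
      (-t⁻¹ / (- Real.log t)) t := by
    intro t ht
    have h1 := hlog t ht
    rw [one_div, Real.log_inv] at h1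
    exact ((Real.hasDerivAt_log ht.1.ne').neg).log h1.ne'
  have hmem : Ioo (0:ℝ) (1/2) ∈ nhdsWithin (0:ℝ) (Ioi 0) := Ioo_mem_nhdsGT (by norm_num)
  refine not_integrableOn_of_tendsto_norm_atTop_of_deriv_isBigO_filter
    (f := fun t => Real.log (-Real.log t)) (nhdsWithin (0:ℝ) (Ioi 0)) hmem ?_ ?_ ?_ hint
  · filter_upwards [hmem] with t ht using (hd t ht).differentiableAt
  · apply tendsto_norm_atTop_atTop.comp
    apply Real.tendsto_log_atTop.comp
    exact Filter.tendsto_neg_atBot_atTop.comp Real.tendsto_log_nhdsGT_zero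
  · apply Asymptotics.IsBigO.of_bound (c⁻¹)
    filter_upwards [hmem] with t ht
    rw [(hd t ht).deriv]
    simp only [hG, one_div, Real.log_inv, norm_mul, norm_div, norm_neg, norm_inv]
    rw [Real.norm_of_nonneg hc.le]
    apply le_of_eq
    field_simp

def sgn (n : ℕ) : ℝ := (-1) ^ n
def ang (n i : ℕ) : ℝ := i / (4 * √(n : ℝ))
def dirv (n i : ℕ) : E2 := !₂[sgn n * Real.cos (ang n i), sgn n * Real.sin (ang n i)]

lemma sgn_sq (n : ℕ) : sgn n * sgn n = 1 := by
  unfold sgn; rw [← pow_add, ← two_mul, pow_mul]; norm_num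

lemma inner_dirv (n i m k : ℕ) :
    inner ℝ (dirv n i) (dirv m k) = sgn n * sgn m * Real.cos (ang n i - ang m k) := by
  simp [dirv, PiLp.inner_apply, Fin.sum_univ_two, Real.cos_sub]
  ring

lemma norm_dirv (n i : ℕ) : ‖dirv n i‖ = 1 := by
  have h : ‖dirv n i‖ ^ 2 = 1 := by
    rw [← real_inner_self_eq_norm_sq, inner_dirv, sgn_sq]; simp
  nlinarith [norm_nonneg (dirv n i)]

def qf (n i : ℕ) (s : ℝ) : ℝ := 1 / 240 * Real.exp (s - (√(n : ℝ) ^ 3 + i)) / √(n : ℝ) ^ 3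

def good (n i : ℕ) : Prop := 10000 ≤ n ∧ (i : ℝ) ≤ 2 * √(n : ℝ) + 1

lemma good.sqrt {n i : ℕ} (h : good n i) : 100 ≤ √(n : ℝ) := by
  apply Real.le_sqrt_of_sq_le
  have : (10000 : ℝ) ≤ n := by exact_mod_cast h.1
  linarith

lemma qf_pos {n i : ℕ} (h : good n i) (s : ℝ) : 0 < qf n i s := by
  have := h.sqrt
  unfold qf
  have : 0 < √(n : ℝ) := by linarith
  positivity

lemma qf_le {n i : ℕ} (h : good n i) {s : ℝ} (hs : s ≤ √(n : ℝ) ^ 3 + i + 1) :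
    qf n i s ≤ 1 / (80 * √(n : ℝ) ^ 3) := by
  have := h.sqrt
  have h0 : 0 < √(n : ℝ) := by linarith
  have h1 : Real.exp (s - (√(n : ℝ) ^ 3 + i)) ≤ 3 :=
    (Real.exp_le_exp.2 (by linarith : s - (√(n : ℝ) ^ 3 + i) ≤ 1)).trans
      (by linarith [Real.exp_one_lt_d9])
  unfold qf
  rw [div_le_div_iff₀ (by positivity) (by positivity)]
  have : 0 < √(n : ℝ) ^ 3 := by positivity
  nlinarith

lemma ang_bd {n i : ℕ} (h : good n i) : 0 ≤ ang n i ∧ ang n i ≤ 3 / 4 := by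
  have := h.sqrt
  have h0 : 0 < √(n : ℝ) := by linarith
  unfold ang
  refine ⟨by positivity, ?_⟩
  rw [div_le_iff₀ (by positivity)]
  have := h.2
  linarith

lemma cos_nonneg' {n i m k : ℕ} (h : good n i) (h' : good m k) :
    0 ≤ Real.cos (ang n i - ang m k) := by
  obtain ⟨h1, h2⟩ := ang_bd h
  obtain ⟨h3, h4⟩ := ang_bd h'
  have := Real.pi_gt_three
  apply Real.cos_nonneg_of_mem_Icc
  constructor <;> linarith

lemma cos_sep {n i k : ℕ} (h : good n i) (h' : good n k) (hik : k ≠ i) :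
    Real.cos (ang n k - ang n i) ≤ 1 - 1 / (80 * √(n : ℝ) ^ 2) := by
  obtain ⟨h1, h2⟩ := ang_bd h
  obtain ⟨h3, h4⟩ := ang_bd h'
  have hr := h.sqrt
  have h0 : 0 < √(n : ℝ) := by linarith
  have hp := Real.pi_gt_three
  have hp' := Real.pi_lt_d2
  have hc := Real.cos_le_one_sub_mul_cos_sq (x := ang n k - ang n i)
    (abs_le.2 ⟨by linarith, by linarith⟩)
  refine hc.trans ?_
  have hsq : 1 / (16 * √(n : ℝ) ^ 2) ≤ (ang n k - ang n i) ^ 2 := by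
    have : (ang n k - ang n i) ^ 2 = ((k : ℝ) - i) ^ 2 / (16 * √(n : ℝ) ^ 2) := by
      unfold ang; field_simp; ring
    rw [this]
    have h5 : (1 : ℝ) ≤ ((k : ℝ) - i) ^ 2 := by
      have h6 : (1 : ℤ) ≤ ((k : ℤ) - i) ^ 2 := by
        have : ((k : ℤ) - i) ≠ 0 := by omega
        have := sq_pos_of_ne_zero this
        omega
      exact_mod_cast h6
    gcongr
  have hpi : 1 / 5 ≤ 2 / Real.pi ^ 2 := by
    rw [div_le_div_iff₀ (by norm_num) (by positivity)]
    nlinarith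
  have : 1 / (80 * √(n : ℝ) ^ 2) = 1 / 5 * (1 / (16 * √(n : ℝ) ^ 2)) := by field_simp; norm_num
  have h7 : 1 / 5 * (1 / (16 * √(n : ℝ) ^ 2)) ≤ 2 / Real.pi ^ 2 * (ang n k - ang n i) ^ 2 := by
    gcongr
  linarith

lemma inv_drop {n m i : ℕ} (h : good n i) (hm : n + 1 ≤ m) :
    1 / √(m : ℝ) ≤ 1 / √(n : ℝ) - 1 / (80 * √(n : ℝ) ^ 3) := by
  have hr := h.sqrt
  set r := √(n : ℝ) with hrd
  have hrs : r ^ 2 = n := Real.sq_sqrt (by positivity)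
  set r' := √((n : ℝ) + 1) with hrd'
  have hrs' : r' ^ 2 = n + 1 := Real.sq_sqrt (by positivity)
  have hr0' : 0 ≤ r' := Real.sqrt_nonneg _
  have hlt : r < r' := by nlinarith
  have hle : r' ≤ 2 * r := by nlinarith
  have h1 : 1 / √(m : ℝ) ≤ 1 / r' := by
    have : r' ≤ √(m : ℝ) := Real.sqrt_le_sqrt (by exact_mod_cast hm)
    have : 0 < r' := by linarith
    gcongr
  refine h1.trans ?_
  have hr0 : 0 < r := by linarith
  have hr1 : 0 < r' := by linarith
  have e1 : 1 / r - 1 / r' = (r' - r) / (r * r') := by field_simp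
  have e2 : r' - r = 1 / (r' + r) := by
    rw [eq_div_iff (by positivity)]; nlinarith
  have e3 : 1 / (80 * r ^ 3) ≤ 1 / r - 1 / r' := by
    rw [e1, e2, div_div]
    apply one_div_le_one_div_of_le (by positivity)
    have : (r' + r) * (r * r') ≤ (3 * r) * (r * (2 * r)) := by gcongr; linarith
    have : 0 < r ^ 3 := by positivity
    nlinarith
  linarith

lemma far {n m k : ℕ} (h' : good m k) (hm : m + 2 ≤ n) {s : ℝ} (hs : √(n : ℝ) ^ 3 ≤ s) :
    1 / √(m : ℝ) ≤ qf m k s := by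
  have hr := h'.sqrt
  have hk := h'.2
  unfold qf
  set r := √(m : ℝ) with hrd
  have hrs : r ^ 2 = m := Real.sq_sqrt (by positivity)
  set r' := √((m : ℝ) + 2) with hrd'
  have hrs' : r' ^ 2 = m + 2 := Real.sq_sqrt (by positivity)
  have hr0' : 0 ≤ r' := Real.sqrt_nonneg _
  have hle : r' ≤ √(n : ℝ) := Real.sqrt_le_sqrt (by exact_mod_cast hm)
  have h1 : r' ^ 3 ≤ √(n : ℝ) ^ 3 := by gcongr
  have hlt : r < r' := by nlinarith
  have h2 : r ^ 3 + 3 * r ≤ r' ^ 3 := by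
    have e1 : r' ^ 2 = r ^ 2 + 2 := by linarith
    have e2 : (r' - r) * (r' + r) = 2 := by nlinarith
    have e3 : r' ^ 3 - r ^ 3 = (r' - r) * (3 / 4 * (r' + r) ^ 2 + 1 / 4 * (r' - r) ^ 2) := by ring
    have e4 : (r' - r) * (3 / 4 * (r' + r) ^ 2) = 3 / 2 * (r' + r) := by
      linear_combination 3 / 4 * (r' + r) * e2
    have e5 : 0 ≤ (r' - r) * (1 / 4 * (r' - r) ^ 2) := by
      have : 0 ≤ r' - r := by linarith
      positivity
    linarith
  have h3 : r - 1 ≤ s - (r ^ 3 + k) := by linarith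
  have h4 : 240 * r ^ 2 ≤ Real.exp (r - 1) := by
    have h5 := Real.pow_div_factorial_le_exp (x := r - 1) (by linarith) 4
    refine le_trans ?_ h5
    have h6 : ((Nat.factorial 4 : ℕ) : ℝ) = 24 := by norm_num [Nat.factorial]
    rw [h6, le_div_iff₀ (by norm_num)]
    obtain ⟨y, hy⟩ : ∃ y, y = r - 1 := ⟨_, rfl⟩
    have hry : r = y + 1 := by linarith
    rw [hry] at hr ⊢
    have h7 : y + 1 ≤ 2 * y := by linarith
    have h8 : (y + 1) ^ 2 ≤ (2 * y) ^ 2 := by gcongr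
    have h9 : (99 : ℝ) ^ 2 ≤ y ^ 2 := by gcongr; linarith
    have h10 : (y + 1) ^ 2 ≤ 2 * y ^ 2 := by nlinarith
    have h11 : 99 ^ 2 * y ^ 2 ≤ y ^ 2 * y ^ 2 := by gcongr
    have e : (y + 1 - 1) ^ 4 = y ^ 2 * y ^ 2 := by ring
    rw [e]
    nlinarith
  have h5 : 240 * r ^ 2 ≤ Real.exp (s - (r ^ 3 + k)) := h4.trans (Real.exp_le_exp.2 h3)
  rw [div_le_div_iff₀ (by linarith) (by positivity)]
  have : 0 < r := by linarith
  nlinarith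

lemma key {n i m k : ℕ} (h : good n i) (h' : good m k) {s : ℝ} (hs : √(n : ℝ) ^ 3 + i ≤ s)
    (hs' : s ≤ √(n : ℝ) ^ 3 + i + 1) :
    1 / √(m : ℝ) * (sgn m * sgn n * Real.cos (ang m k - ang n i)) - qf m k s ≤
      1 / √(n : ℝ) - qf n i s := by
  have hq := qf_le h hs'
  have hq' := qf_pos h' s
  have hr := h.sqrt
  have hr' := h'.sqrt
  have hc0 := cos_nonneg' h' h
  have hc1 := Real.cos_le_one (ang m k - ang n i)
  have h0 : 0 < √(n : ℝ) := by linarith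
  have h0' : 0 < √(m : ℝ) := by linarith
  have hsg : sgn m * sgn n ≤ 1 := by
    have h1 := sgn_sq m
    have h2 := sgn_sq n
    nlinarith [sq_nonneg (sgn m - sgn n)]
  have hle1 : sgn m * sgn n * Real.cos (ang m k - ang n i) ≤ Real.cos (ang m k - ang n i) := by
    nlinarith
  have hi0 : (0 : ℝ) < 1 / √(m : ℝ) := by positivity
  have hA := mul_le_mul_of_nonneg_left hle1 hi0.le
  have hB := mul_le_mul_of_nonneg_left hc1 hi0.le
  have hq3 : 1 / (80 * √(n : ℝ) ^ 3) ≤ 1 / √(n : ℝ) := by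
    apply one_div_le_one_div_of_le h0
    have : 1 ≤ √(n : ℝ) ^ 2 := by nlinarith
    nlinarith
  have hi : (0 : ℝ) ≤ i := by positivity
  rcases lt_trichotomy m n with hmn | hmn | hmn
  · by_cases h1 : m + 1 = n
    · have : sgn m * sgn n = -1 := by
        subst h1
        have := sgn_sq m
        unfold sgn at *
        rw [pow_succ]; linarith
      rw [this]
      have : 0 ≤ 1 / √(m : ℝ) * Real.cos (ang m k - ang n i) := by positivity
      linarith
    · have := far h' (show m + 2 ≤ n by omega) (show √(n : ℝ) ^ 3 ≤ s by linarith)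
      linarith
  · subst hmn
    by_cases hik : k = i
    · subst hik
      rw [sgn_sq]; simp
    · have := cos_sep h h' hik
      have hC := mul_le_mul_of_nonneg_left this hi0.le
      have e : 1 / √(m : ℝ) * (1 - 1 / (80 * √(m : ℝ) ^ 2)) =
        1 / √(m : ℝ) - 1 / (80 * √(m : ℝ) ^ 3) := by field_simp
      linarith
  · have := inv_drop h (show n + 1 ≤ m by omega)
    linarith

lemma exists_block {s : ℝ} (hs : (100 : ℝ) ^ 3 ≤ s) :
    ∃ n i : ℕ, good n i ∧ √(n : ℝ) ^ 3 + i ≤ s ∧ s ≤ √(n : ℝ) ^ 3 + i + 1 := by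
  have hex : ∃ m : ℕ, s < √(m : ℝ) ^ 3 := by
    obtain ⟨m, hm⟩ := exists_nat_gt s
    refine ⟨m ^ 2, ?_⟩
    push_cast
    rw [Real.sqrt_sq (by positivity)]
    have : (1 : ℝ) ≤ m := by linarith
    have := le_self_pow₀ this (show 3 ≠ 0 by norm_num)
    linarith
  classical
  have hsp := Nat.find_spec hex
  have hmin := fun k => Nat.find_min (m := k) hex
  set M := Nat.find hex with hM
  have hM1 : 10000 < M := by
    by_contra hcon
    have h1 : (M : ℝ) ≤ 100 ^ 2 := by
      have : (M : ℝ) ≤ 10000 := by exact_mod_cast not_lt.1 hcon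
      linarith
    have h2 : √(M : ℝ) ≤ 100 := by
      rw [Real.sqrt_le_left (by norm_num)]; exact h1
    have h3 : √(M : ℝ) ^ 3 ≤ 100 ^ 3 := by gcongr
    linarith
  obtain ⟨n, hn⟩ : ∃ n, M = n + 1 := ⟨M - 1, by omega⟩
  rw [hn] at hsp
  have hlow := not_lt.1 (hmin n (by omega))
  have hd : 0 ≤ s - √(n : ℝ) ^ 3 := by linarith
  have hf1 := Nat.floor_le hd
  have hf2 := (Nat.lt_floor_add_one (s - √(n : ℝ) ^ 3)).le
  refine ⟨n, ⌊s - √(n : ℝ) ^ 3⌋₊, ⟨by omega, ?_⟩, by linarith, by linarith⟩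
  refine hf1.trans ?_
  push_cast at hsp
  have hn0 : (10000 : ℝ) ≤ n := by exact_mod_cast (show 10000 ≤ n by omega)
  set r := √(n : ℝ) with hrd
  have hrs : r ^ 2 = n := Real.sq_sqrt (by positivity)
  set r' := √((n : ℝ) + 1) with hrd'
  have hrs' : r' ^ 2 = n + 1 := Real.sq_sqrt (by positivity)
  have hr0' : 0 ≤ r' := Real.sqrt_nonneg _
  have hr0 : 0 ≤ r := Real.sqrt_nonneg _
  have hr1 : 1 ≤ r := by nlinarith
  have hlt : r < r' := by nlinarith
  have e2 : (r' - r) * (r' + r) = 1 := by nlinarith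
  have hle : r' ≤ r + 1 := by nlinarith
  have e3 : r' ^ 3 - r ^ 3 ≤ r' + r := by
    have : r' ^ 3 - r ^ 3 = (r' - r) * (r' + r) * (r' + r) - (r' - r) * (r' * r) := by ring
    rw [this, e2]
    have : 0 ≤ (r' - r) * (r' * r) := mul_nonneg (by linarith) (by positivity)
    linarith
  linarith

abbrev Idx : Type := {p : ℕ × ℕ // good p.1 p.2}

instance : Nonempty Idx := ⟨⟨(10000, 0), by unfold good; constructor <;> simp; positivity⟩⟩

def av (p : Idx) : E2 := (1 / √(p.1.1 : ℝ)) • dirv p.1.1 p.1.2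
def bv (p : Idx) : ℝ := qf p.1.1 p.1.2 0

lemma norm_av (p : Idx) : ‖av p‖ = 1 / √(p.1.1 : ℝ) := by
  rw [av, norm_smul, norm_dirv, mul_one, Real.norm_of_nonneg (by positivity)]

lemma norm_av_le (p : Idx) : ‖av p‖ ≤ 1 := by
  rw [norm_av]
  have := p.2.sqrt
  rw [div_le_one (by linarith)]; linarith

lemma bv_pos (p : Idx) : 0 < bv p := qf_pos p.2 0

lemma av_fin (ε : ℝ) (hε : ε > 0) : {p : Idx | ε < ‖av p‖}.Finite := by
  obtain ⟨N, hN⟩ := exists_nat_gt ((1 / ε) ^ 2)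
  have hfin : (Set.Iic ((N, 3 * N) : ℕ × ℕ)).Finite := Set.finite_Iic _
  refine (hfin.preimage (f := fun p : Idx => p.1) Subtype.val_injective.injOn).subset ?_
  intro p hp
  have hp : ε < ‖av p‖ := hp
  rw [norm_av] at hp
  have hr := p.2.sqrt
  have hi := p.2.2
  have hrs : √(p.1.1 : ℝ) ^ 2 = p.1.1 := Real.sq_sqrt (by positivity)
  have h0 : 0 < √(p.1.1 : ℝ) := by linarith
  have h1 : √(p.1.1 : ℝ) < 1 / ε := by
    rw [lt_div_iff₀ h0] at hp
    rw [lt_div_iff₀ hε]; linarith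
  have h2 : √(p.1.1 : ℝ) ^ 2 < (1 / ε) ^ 2 := by gcongr
  have h3 : (p.1.1 : ℝ) ≤ N := by linarith
  have h4 : (p.1.2 : ℝ) ≤ 3 * N := by nlinarith
  refine ⟨?_, ?_⟩
  · exact_mod_cast h3
  · exact_mod_cast h4

lemma bv_eq (p : Idx) (s : ℝ) : bv p = Real.exp (-s) * qf p.1.1 p.1.2 s := by
  unfold bv qf
  have : Real.exp (0 - (√(p.1.1 : ℝ) ^ 3 + p.1.2)) =
    Real.exp (-s) * Real.exp (s - (√(p.1.1 : ℝ) ^ 3 + p.1.2)) := by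
    rw [← Real.exp_add]; congr 1; ring
  rw [this]; ring

lemma small_t {C : ℝ} (hC : 0 ≤ C) {s : ℝ} (hs : (100 : ℝ) ^ 3 ≤ s) :
    ∃ θ : E2, ‖θ‖ = 1 ∧
      1 / 240 * (Real.exp (-s) / s) ≤ Nrad (ffun C av bv) (Real.exp (-s)) θ := by
  obtain ⟨n, i, hg, h1, h2⟩ := exists_block hs
  refine ⟨dirv n i, norm_dirv n i, ?_⟩
  have het := Real.exp_pos (-s)
  have hform : ∀ p : Idx, inner ℝ (av p) (Real.exp (-s) • dirv n i) - bv p =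
      Real.exp (-s) * (1 / √(p.1.1 : ℝ) * (sgn p.1.1 * sgn n *
        Real.cos (ang p.1.1 p.1.2 - ang n i)) - qf p.1.1 p.1.2 s) := by
    intro p
    rw [bv_eq p s, av, inner_smul_left, inner_smul_right, inner_dirv]
    simp; ring
  have hj : inner ℝ (av ⟨(n, i), hg⟩) (Real.exp (-s) • dirv n i) - bv ⟨(n, i), hg⟩ =
      Real.exp (-s) * (1 / √(n : ℝ) - qf n i s) := by
    rw [hform]; simp [sgn_sq]
  have hr := hg.sqrt
  have h0 : 0 < √(n : ℝ) := by linarith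
  have hle := Nrad_lower_active hC norm_av_le bv_pos het (norm_dirv n i) ⟨(n, i), hg⟩ ?_ ?_
  · refine le_trans ?_ hle
    rw [bv_eq _ s]
    have e : 1 / 240 * (Real.exp (-s) / s) = Real.exp (-s) * (1 / 240 * 1 / s) := by ring
    rw [e]
    apply mul_le_mul_of_nonneg_left _ het.le
    unfold qf
    have h3 : 1 ≤ Real.exp (s - (√(n : ℝ) ^ 3 + i)) := Real.one_le_exp (by linarith)
    have h4 : √(n : ℝ) ^ 3 ≤ s := by
      have : (0 : ℝ) ≤ i := by positivity
      linarith
    gcongr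
  · rw [hj]
    apply mul_nonneg het.le
    have hq := qf_le hg h2
    have hq3 : 1 / (80 * √(n : ℝ) ^ 3) ≤ 1 / √(n : ℝ) := by
      apply one_div_le_one_div_of_le h0
      have : 1 ≤ √(n : ℝ) ^ 2 := by nlinarith
      nlinarith
    linarith
  · intro p
    rw [hj, hform]
    exact mul_le_mul_of_nonneg_left (key hg p.2 h1 h2) het.le

/-- Construction of a convex function violating the Dini condition (Proposition 7.7). -/
theorem dini_violating_convex_function (C₁ : ℝ) (hC₁ : 0 ≤ C₁) :
    ∃ (f : EuclideanSpace ℝ (Fin 2) → ℝ) (cstar : ℝ), 0 < cstar ∧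
      ConvexOn ℝ (Metric.closedBall (0 : EuclideanSpace ℝ (Fin 2)) (1/2)) f ∧
      f 0 = 0 ∧
      (∀ x ∈ Metric.closedBall (0 : EuclideanSpace ℝ (Fin 2)) (1/2), 0 ≤ f x) ∧
      (∃ B : ℝ, ∀ x ∈ Metric.closedBall (0 : EuclideanSpace ℝ (Fin 2)) (1/2), f x ≤ B) ∧
      (∀ θ : EuclideanSpace ℝ (Fin 2), ‖θ‖ = 1 →
        Filter.Tendsto (fun t : ℝ => f (t • θ) / t) (nhdsWithin 0 (Ioi 0)) (nhds C₁)) ∧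
      (∀ t ∈ Ioo (0:ℝ) (1/2),
        cstar * (t / Real.log (1 / t)) ≤
          sSup {a : ℝ | ∃ θ : EuclideanSpace ℝ (Fin 2), ‖θ‖ = 1 ∧ a = Nrad f t θ}) ∧
      ∫⁻ t in Ioo (0:ℝ) (1/2),
          ENNReal.ofReal
            ((sSup {a : ℝ | ∃ θ : EuclideanSpace ℝ (Fin 2), ‖θ‖ = 1 ∧ a = Nrad f t θ}) / t ^ 2)
        = ⊤ := by

  have hlow : ∀ t ∈ Ioo (0:ℝ) (1/2),
      min (1 / 240) (Real.exp (-(100 : ℝ) ^ 3) / 2) * (t / Real.log (1 / t)) ≤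
        sSup {r : ℝ | ∃ θ : E2, ‖θ‖ = 1 ∧ r = Nrad (ffun C₁ av bv) t θ} := by
    intro t ht
    have hbdd := Nrad_bdd (a := av) (b := bv) hC₁ norm_av_le bv_pos ht
    obtain ⟨ht0, ht1⟩ := ht
    have hl2 : Real.log 2 ≤ Real.log (1 / t) := by
      apply Real.log_le_log (by norm_num)
      rw [le_div_iff₀ ht0]; linarith
    have hl : 1 / 2 < Real.log (1 / t) := by linarith [Real.log_two_gt_d9]
    have hdiv : 0 ≤ t / Real.log (1 / t) := by positivity
    by_cases hs : (100 : ℝ) ^ 3 ≤ Real.log (1 / t)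
    · obtain ⟨θ, hθ, h⟩ := small_t hC₁ hs
      have he : Real.exp (-Real.log (1 / t)) = t := by
        rw [one_div, Real.log_inv, neg_neg, Real.exp_log ht0]
      rw [he] at h
      refine le_trans ?_ (h.trans (le_csSup hbdd ⟨θ, hθ, rfl⟩))
      exact mul_le_mul_of_nonneg_right (min_le_left _ _) hdiv
    · have h := Nrad_lower_sq (a := av) (b := bv) hC₁ norm_av_le bv_pos ht0 (norm_dirv 0 0)
      refine le_trans ?_ (h.trans (le_csSup hbdd ⟨_, norm_dirv 0 0, rfl⟩))
      refine (mul_le_mul_of_nonneg_right (min_le_right _ _) hdiv).trans ?_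
      have he : Real.exp (-(100 : ℝ) ^ 3) ≤ t := by
        rw [← Real.le_log_iff_exp_le ht0]
        rw [one_div, Real.log_inv] at hs
        linarith
      have h2 : t / Real.log (1 / t) ≤ 2 * t := by
        rw [div_le_iff₀ (by linarith)]
        nlinarith
      calc Real.exp (-(100 : ℝ) ^ 3) / 2 * (t / Real.log (1 / t))
          ≤ t / 2 * (2 * t) := by gcongr
        _ = t ^ 2 := by ring
  have hc : 0 < min (1 / 240) (Real.exp (-(100 : ℝ) ^ 3) / 2) :=
    lt_min (by norm_num) (by positivity)
  refine ⟨ffun C₁ av bv, _, hc, (ffun_convex hC₁ norm_av_le bv_pos).subset (subset_univ _)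
    (convex_closedBall _ _), ?_, ?_, ⟨C₁ * (1 / 2) + (1 / 2) ^ 2 + 1 / 2, ?_⟩, ?_, hlow,
    integral_top hc _ hlow⟩
  · simp [ffun, hsup_zero norm_av_le bv_pos]
  · intro x _
    have := hsup_nonneg (a := av) (b := bv) x
    unfold ffun
    positivity
  · intro x hx
    rw [mem_closedBall_zero_iff] at hx
    have := hsup_le_norm norm_av_le bv_pos x
    unfold ffun
    have : ‖x‖ ^ 2 ≤ (1 / 2) ^ 2 := by gcongr
    have : C₁ * ‖x‖ ≤ C₁ * (1 / 2) := by gcongr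
    linarith
  · intro θ hθ
    have h1 := hsup_tendsto norm_av_le bv_pos av_fin θ hθ
    have h2 : Filter.Tendsto (fun t : ℝ => C₁ + t) (nhdsWithin 0 (Ioi 0)) (nhds (C₁ + 0)) :=
      (tendsto_const_nhds.add Filter.tendsto_id).mono_left nhdsWithin_le_nhds
    have h3 := h2.add h1
    rw [add_zero, add_zero] at h3
    refine h3.congr' ?_
    filter_upwards [self_mem_nhdsWithin] with t ht
    have ht : 0 < t := ht
    rw [ffun_line hθ ht.le]
    field_simp
end
end
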